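/- arXiv:2201.06942 — 2 statements merged into one kernel-verified Lean document; each statement's English description precedes it below -/
import Mathlib

section
/- Let d ≥ 2 be an even integer and e an indeterminate. Let n be a positive integer with n ≡ d+1 (mod 2d). Then the truncated sum Σ_{k=0}^{(dn+n−1)/(2d)} [3dk+1]_q · (q,e,q^{1+d}/e; q^{2d})_k (q,q,q^{d−1}; q^d)_k / ((q^d,e,q^{1+d}/e; q^d)_k (q^{2d},q^{2d},q^{d+2}; q^{2d})_k) · q^{dk} is congruent to 0 modulo Φ_n(q)^3, as a congruence of rational functions in q and e. -/
open Finset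

noncomputable section

abbrev R2 : Type := MvPolynomial (Fin 2) ℚ
abbrev K2 : Type := FractionRing R2

/-- The variable `q` as a rational function in `ℚ(q,e)`. -/
def qv : K2 := algebraMap R2 K2 (MvPolynomial.X 0)

/-- The indeterminate `e` as a rational function in `ℚ(q,e)`. -/
def ev : K2 := algebraMap R2 K2 (MvPolynomial.X 1)

/-- The q-shifted factorial `(a; q)_k = (1-a)(1-aq)⋯(1-aq^{k-1})`. -/
def qPoch {R : Type*} [CommRing R] (a q : R) (k : ℕ) : R :=
  ∏ j ∈ Finset.range k, (1 - a * q ^ j)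

/-- The q-integer `[m]_q = (1 - q^m)/(1 - q)`. -/
def qInt {K : Type*} [Field K] (q : K) (m : ℤ) : K := (1 - q ^ m) / (1 - q)

/-- The n-th cyclotomic polynomial `Φ_n(q)` viewed inside `ℚ[q,e]`. -/
def Phi2 (n : ℕ) : R2 := Polynomial.aeval (MvPolynomial.X 0) (Polynomial.cyclotomic n ℚ)

/-- `A ≡ B (mod M)`: the polynomial `M` divides the numerator of the reduced form
of the rational function `A - B`; equivalently, `A - B = M·f/g` with `g` having no
prime factor in common with `M`. -/
def CongrMod2 (A B : K2) (M : R2) : Prop :=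
  ∃ f g : R2, g ≠ 0 ∧ (∀ p : R2, Prime p → p ∣ g → ¬ p ∣ M) ∧
    (A - B) * algebraMap R2 K2 g = algebraMap R2 K2 M * algebraMap R2 K2 f

theorem quadTerm_certificate {K : Type*} [Field K] {p A B F E z : K} (hp : p ≠ 0)
    (hA : A ≠ 0) (hB : B ≠ 0) (hF : F ≠ 0) (hE : E ≠ 0) :
    (1 - A ^ 2 / (p * E * F)) * ((1 - B * F * E / A) * (1 - F * E * p / (A * B))) *
        ((1 - A * z ^ 3) * z) * ((1 - E * z ^ 2) * (1 - A / (p * E) * z) *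
          (1 - A / (p * E) * (p * z))) -
      (1 - A / (B * E)) * (1 - A * B / (p * E)) * (1 - E) * ((1 - A * z ^ 3) * z) *
        ((1 - A ^ 2 / (p * E * F) * z ^ 2) * (1 - E * F / A * (p * z)) * (1 - E * F / A * z)) =
    -(A / (p * E)) * (1 - F * E ^ 2 * p / A ^ 2) *
      ((1 - A * z) * (1 - B * z) * (1 - p / B * z) * (1 - E * z ^ 2) * (1 - F * z ^ 2) *
          (1 - A ^ 2 / (p * E * F) * z ^ 2) -
        (1 - z ^ 2) * (1 - A / B * z ^ 2) * (1 - A * B / p * z ^ 2) *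
          (1 - A / (p * E) * (p * z)) * (1 - A / F * z) * (1 - E * F / A * (p * z))) := by
  field_simp
  ring

theorem certificate_scaling {K : Type*} [Field K]
    {a b b' d f x u₁ u₂ u₃ Y φ g v₁ v₂ v₃ vE vy vy' vφ vg vg' va vb vb' vf vx X' Y' g'
      e h₁ h₂ h₃ h₄ hX w κ c₁ c₂ : K}
    (hu₁ : u₁ ≠ 0) (hu₂ : u₂ ≠ 0) (hu₃ : u₃ ≠ 0) (hY : Y ≠ 0) (hφ : φ ≠ 0) (hg : g ≠ 0)
    (hv₁ : v₁ ≠ 0) (hv₂ : v₂ ≠ 0) (hv₃ : v₃ ≠ 0) (hvy : vy ≠ 0) (hvy' : vy' ≠ 0)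
    (hvφ : vφ ≠ 0) (hvg : vg ≠ 0) (hvg' : vg' ≠ 0) (hh₁ : h₁ ≠ 0) (hh₂ : h₂ ≠ 0)
    (hh₃ : h₃ ≠ 0) (hh₄ : h₄ ≠ 0) (hhX : hX ≠ 0)
    (eX : X' * hX = x * vx) (eY : Y' * (h₁ * h₂) = Y * vy * vy') (eg : g' * vg' = h₃ * h₄ * g)
    (key : hX * c₁ * w * (vE * vy * vy') - c₂ * e * w * (vx * vg * vg') =
      κ * (va * vb * vb' * vE * vf * vx - v₁ * v₂ * v₃ * vy' * vφ * vg)) :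
    h₁ * h₂ * c₁ * (w * (a * b * b' * (d * vE) * f * x) /
        ((u₁ * v₁) * (u₂ * v₂) * (u₃ * v₃) * Y * (φ * vφ) * (g * vg))) -
      h₃ * h₄ * c₂ * (w * (a * b * b' * (e * d) * f * X') /
        ((u₁ * v₁) * (u₂ * v₂) * (u₃ * v₃) * Y' * (φ * vφ) * g')) =
    κ * h₁ * h₂ / hX * ((a * va) * (b * vb) * (b' * vb') * (d * vE) * (f * vf) * (x * vx) /
        ((u₁ * v₁) * (u₂ * v₂) * (u₃ * v₃) * (Y * vy * vy') * (φ * vφ) * (g * vg))) -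
      κ * h₁ * h₂ / hX * (a * b * b' * d * f * x / (u₁ * u₂ * u₃ * (Y * vy) * φ * g)) := by
  obtain rfl : X' = x * vx / hX := by rw [eq_div_iff hhX, eX]
  obtain rfl : Y' = Y * vy * vy' / (h₁ * h₂) := by
    rw [eq_div_iff (mul_ne_zero hh₁ hh₂), eY]
  obtain rfl : g' = h₃ * h₄ * g / vg' := by rw [eq_div_iff hvg', eg]
  field_simp
  linear_combination (a * b * b' * d * f * x) * key

theorem qPoch_succ {R : Type*} [CommRing R] (a q : R) (k : ℕ) :
    qPoch a q (k + 1) = qPoch a q k * (1 - a * q ^ k) :=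
  Finset.prod_range_succ _ _

theorem qPoch_succ_left {R : Type*} [CommRing R] (a q : R) (k : ℕ) :
    qPoch a q (k + 1) = (1 - a) * qPoch (a * q) q k := by
  rw [qPoch, Finset.prod_range_succ', mul_comm]
  simp [qPoch, pow_succ', mul_assoc]

@[simp]
theorem qPoch_zero {R : Type*} [CommRing R] (a q : R) : qPoch a q 0 = 1 :=
  Finset.prod_range_zero _

/-- The `k`-th term of the very-well-poised quadratic series with base `p` and parameters
`A, B, D, F`, normalised by the factor `1 - A`. -/
def quadTerm {K : Type*} [Field K] (p F A B D : K) (k : ℕ) : K :=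
  ((1 - A * (p ^ k) ^ 3) * p ^ k) *
    (qPoch A p k * qPoch B p k * qPoch (p / B) p k * qPoch D (p ^ 2) k * qPoch F (p ^ 2) k *
      qPoch (A ^ 2 * p / (D * F)) (p ^ 2) k) /
    (qPoch (p ^ 2) (p ^ 2) k * qPoch (A * p ^ 2 / B) (p ^ 2) k * qPoch (A * B * p) (p ^ 2) k *
      qPoch (A * p / D) p k * qPoch (A * p / F) p k * qPoch (D * F / A) p k)

theorem quadTerm_sum_recurrence {K : Type*} [Field K] {p F A B E : K} (hp : p ≠ 0) (hA : A ≠ 0)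
    (hB : B ≠ 0) (hF : F ≠ 0) (hE : E ≠ 0) (hX : 1 - A ^ 2 / (p * E * F) ≠ 0) (m : ℕ)
    (h₁ : qPoch (p ^ 2) (p ^ 2) m ≠ 0) (h₂ : qPoch (A * p ^ 2 / B) (p ^ 2) m ≠ 0)
    (h₃ : qPoch (A * B * p) (p ^ 2) m ≠ 0) (hy : qPoch (A / (p * E)) p (m + 2) ≠ 0)
    (hφ : qPoch (A * p / F) p m ≠ 0) (hg : qPoch (E * F / A) p (m + 2) ≠ 0) :
    (1 - A / (p * E)) * (1 - A / (p * E) * p) *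
          ((1 - B * F * E / A) * (1 - F * E * p / (A * B))) *
        ∑ k ∈ range (m + 1), quadTerm p F A B (E * p ^ 2) k -
      (1 - E * F / A) * (1 - E * F / A * p) * ((1 - A / (B * E)) * (1 - A * B / (p * E))) *
        ∑ k ∈ range (m + 1), quadTerm p F A B E k =
    -(A / (p * E)) * (1 - F * E ^ 2 * p / A ^ 2) * (1 - A / (p * E)) * (1 - A / (p * E) * p) /
        (1 - A ^ 2 / (p * E * F)) *
      (qPoch A p (m + 1) * qPoch B p (m + 1) * qPoch (p / B) p (m + 1) *
        qPoch (E * p ^ 2) (p ^ 2) m * qPoch F (p ^ 2) (m + 1) *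
        qPoch (A ^ 2 / (p * E * F)) (p ^ 2) (m + 1) /
        (qPoch (p ^ 2) (p ^ 2) m * qPoch (A * p ^ 2 / B) (p ^ 2) m *
          qPoch (A * B * p) (p ^ 2) m * qPoch (A / (p * E)) p (m + 2) * qPoch (A * p / F) p m *
          qPoch (E * F / A * p * p) p m)) := by
  induction m with
  | zero =>
    simp only [qPoch_succ, qPoch_zero, one_mul, pow_zero, mul_one, zero_add, pow_one,
      Finset.sum_range_one, quadTerm, one_pow, div_one] at hy ⊢
    have hy₀ := left_ne_zero_of_mul hy
    have hy₁ := right_ne_zero_of_mul hy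
    generalize hX' : 1 - A ^ 2 / (p * E * F) = X at *
    generalize hY' : 1 - A / (p * E) = Y at *
    generalize hZ' : 1 - A / (p * E) * p = Z at *
    have key : Y * Z * ((1 - B * F * E / A) * (1 - F * E * p / (A * B))) -
        (1 - E * F / A) * (1 - E * F / A * p) * ((1 - A / (B * E)) * (1 - A * B / (p * E))) =
        -(A / (p * E)) * (1 - F * E ^ 2 * p / A ^ 2) * ((1 - B) * (1 - p / B) * (1 - F)) := by
      subst hY' hZ'
      field_simp
      ring
    rw [← sub_mul, key]
    field_simp
  | succ m ih =>
    rw [qPoch_succ] at h₁ h₂ h₃ hφ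
    have hy' := hy
    have hg' := hg
    rw [show m + 1 + 2 = m + 2 + 1 from rfl, qPoch_succ] at hy' hg'
    have ih := ih (left_ne_zero_of_mul h₁) (left_ne_zero_of_mul h₂) (left_ne_zero_of_mul h₃)
      (left_ne_zero_of_mul hy') (left_ne_zero_of_mul hφ) (left_ne_zero_of_mul hg')
    rw [Finset.sum_range_succ, Finset.sum_range_succ _ (m + 1), mul_add, mul_add, add_sub_add_comm,
      ih, add_comm, ← eq_sub_iff_add_eq]
    have hg₃ : qPoch (E * F / A) p (m + 3) =
        (1 - E * F / A) * ((1 - E * F / A * p) * qPoch (E * F / A * p * p) p (m + 1)) := by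
      rw [qPoch_succ_left, qPoch_succ_left]
    rw [hg₃] at hg
    have hg₀ := left_ne_zero_of_mul hg
    have hg₁ := left_ne_zero_of_mul (right_ne_zero_of_mul hg)
    have hg₂ := right_ne_zero_of_mul (right_ne_zero_of_mul hg)
    rw [qPoch_succ] at hg₂
    have hy₃ : qPoch (A / (p * E)) p (m + 3) = (1 - A / (p * E)) *
        ((1 - A / (p * E) * p) * qPoch (A / (p * E) * p * p) p (m + 1)) := by
      rw [qPoch_succ_left, qPoch_succ_left]
    have hy₄ := hy
    rw [hy₃] at hy
    rw [qPoch_succ, qPoch_succ] at hy₄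
    rw [qPoch_succ] at hg'
    have e₁ : A ^ 2 * p / (E * p ^ 2 * F) = A ^ 2 / (p * E * F) := by field_simp
    have e₂ : A ^ 2 * p / (E * F) = A ^ 2 / (p * E * F) * p ^ 2 := by field_simp
    have e₃ : A * p / (E * p ^ 2) = A / (p * E) := by field_simp
    have e₄ : A * p / E = A / (p * E) * p * p := by field_simp
    have e₅ : E * p ^ 2 * F / A = E * F / A * p * p := by ring
    have key := quadTerm_certificate (z := p ^ (m + 1)) hp hA hB hF hE
    have := certificate_scaling (a := qPoch A p (m + 1)) (b := qPoch B p (m + 1))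
      (b' := qPoch (p / B) p (m + 1)) (d := qPoch (E * p ^ 2) (p ^ 2) m)
      (f := qPoch F (p ^ 2) (m + 1)) (x := qPoch (A ^ 2 / (p * E * F)) (p ^ 2) (m + 1))
      (X' := qPoch (A ^ 2 * p / (E * F)) (p ^ 2) (m + 1))
      (Y' := qPoch (A * p / E) p (m + 1)) (g' := qPoch (E * F / A) p (m + 1))
      (left_ne_zero_of_mul h₁) (left_ne_zero_of_mul h₂) (left_ne_zero_of_mul h₃)
      (left_ne_zero_of_mul (left_ne_zero_of_mul hy₄)) (left_ne_zero_of_mul hφ)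
      (left_ne_zero_of_mul hg₂) (right_ne_zero_of_mul h₁) (right_ne_zero_of_mul h₂)
      (right_ne_zero_of_mul h₃) (right_ne_zero_of_mul (left_ne_zero_of_mul hy₄))
      (right_ne_zero_of_mul hy₄) (right_ne_zero_of_mul hφ) (right_ne_zero_of_mul hg₂)
      (right_ne_zero_of_mul (left_ne_zero_of_mul hg'))
      (left_ne_zero_of_mul hy) (left_ne_zero_of_mul (right_ne_zero_of_mul hy)) hg₀ hg₁ hX
      (e := 1 - E) (vE := 1 - E * p ^ 2 * (p ^ 2) ^ m) (va := 1 - A * p ^ (m + 1))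
      (vb := 1 - B * p ^ (m + 1)) (vb' := 1 - p / B * p ^ (m + 1))
      (vf := 1 - F * (p ^ 2) ^ (m + 1)) (vx := 1 - A ^ 2 / (p * E * F) * (p ^ 2) ^ (m + 1))
      (w := (1 - A * (p ^ (m + 1)) ^ 3) * p ^ (m + 1))
      (κ := -(A / (p * E)) * (1 - F * E ^ 2 * p / A ^ 2))
      (c₁ := (1 - B * F * E / A) * (1 - F * E * p / (A * B)))
      (c₂ := (1 - A / (B * E)) * (1 - A * B / (p * E)))
      (by rw [← qPoch_succ, e₂, mul_comm, ← qPoch_succ_left])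
      (by rw [← qPoch_succ, ← qPoch_succ, hy₃, e₄]; ring)
      (by rw [← qPoch_succ, qPoch_succ_left, qPoch_succ_left]; ring)
      (by
        convert key using 2
        · ring
        · ring
        · have : (p ^ 2) ^ (m + 1) = (p ^ (m + 1)) ^ 2 := by ring
          have h2 : p ^ 2 * (p ^ 2) ^ m = (p ^ (m + 1)) ^ 2 := by ring
          have h3 : E * p ^ 2 * (p ^ 2) ^ m = E * (p ^ (m + 1)) ^ 2 := by ring
          have h4 : A * p ^ 2 / B * (p ^ 2) ^ m = A / B * (p ^ (m + 1)) ^ 2 := by ring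
          have h5 : A * B * p * (p ^ 2) ^ m = A * B / p * (p ^ (m + 1)) ^ 2 := by
            field_simp; ring
          have h6 : A / (p * E) * p ^ (m + 2) = A / (p * E) * (p * p ^ (m + 1)) := by ring
          have h7 : A * p / F * p ^ m = A / F * p ^ (m + 1) := by ring
          have h8 : E * F / A * p * p * p ^ m = E * F / A * (p * p ^ (m + 1)) := by ring
          rw [this, h2, h3, h4, h5, h6, h7, h8])
    simp only [quadTerm, e₁, e₃, e₅]
    simp only [← qPoch_succ, ← qPoch_succ_left] at this
    exact this

/-- The parameter `A` avoids the finitely many values (up to exponent `N`) at which the quadratic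
series or its recurrence has a vanishing denominator. -/
structure GenericParam {K : Type*} [Field K] (p F B A : K) (N : ℕ) : Prop where
  ne_zero : A ≠ 0
  ne_B : ∀ a ∈ range N, ∀ b ∈ range N, A * p ^ a ≠ B * p ^ b
  mul_B_ne : ∀ a ∈ range N, ∀ b ∈ range N, A * B * p ^ a ≠ p ^ b
  ne_one : ∀ a ∈ range N, ∀ b ∈ range N, A * p ^ a ≠ p ^ b
  ne_F : ∀ a ∈ range N, ∀ b ∈ range N, A * p ^ a ≠ F * p ^ b
  sq_ne_F : ∀ a ∈ range N, ∀ b ∈ range N, A ^ 2 * p ^ a ≠ F * p ^ b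

theorem eventually_mul_ne {K : Type*} [Field K] {c : K} (hc : c ≠ 0) (y : K) :
    ∀ᶠ A : K in Filter.cofinite, A * c ≠ y := by
  refine (Set.finite_singleton (y / c)).subset fun A hA => ?_
  simp only [Set.mem_compl_iff, Set.mem_ofPred_eq, not_not] at hA
  rw [Set.mem_singleton_iff, eq_div_iff hc, hA]

theorem eventually_sq_mul_ne {K : Type*} [Field K] {c : K} (hc : c ≠ 0) (y : K) :
    ∀ᶠ A : K in Filter.cofinite, A ^ 2 * c ≠ y := by
  by_cases h : ∃ r : K, r ^ 2 * c = y
  · obtain ⟨r, rfl⟩ := h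
    refine (Set.toFinite {r, -r}).subset fun A hA => ?_
    simp only [Set.mem_compl_iff, Set.mem_ofPred_eq, not_not] at hA
    exact sq_eq_sq_iff_eq_or_eq_neg.1 (mul_right_cancel₀ hc hA)
  · exact Filter.Eventually.of_forall fun A hA => h ⟨A, hA⟩

theorem eventually_genericParam {K : Type*} [Field K] {p F B : K} (hp : p ≠ 0) (hB : B ≠ 0)
    (N : ℕ) : ∀ᶠ A in Filter.cofinite, GenericParam p F B A N := by
  have h (a : ℕ) : p ^ a ≠ 0 := pow_ne_zero a hp
  have h₀ : ∀ᶠ A : K in Filter.cofinite, A ≠ 0 := by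
    simp
  have h₁ : ∀ᶠ A : K in Filter.cofinite, ∀ a ∈ range N, ∀ b ∈ range N, A * p ^ a ≠ B * p ^ b := by
    simp only [Filter.eventually_all_finset]
    exact fun a _ b _ => eventually_mul_ne (h a) _
  have h₂ : ∀ᶠ A : K in Filter.cofinite, ∀ a ∈ range N, ∀ b ∈ range N,
      A * B * p ^ a ≠ p ^ b := by
    simp only [Filter.eventually_all_finset, mul_assoc]
    exact fun a _ b _ => eventually_mul_ne (mul_ne_zero hB (h a)) _
  have h₃ : ∀ᶠ A : K in Filter.cofinite, ∀ a ∈ range N, ∀ b ∈ range N, A * p ^ a ≠ p ^ b := by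
    simp only [Filter.eventually_all_finset]
    exact fun a _ b _ => eventually_mul_ne (h a) _
  have h₄ : ∀ᶠ A : K in Filter.cofinite, ∀ a ∈ range N, ∀ b ∈ range N, A * p ^ a ≠ F * p ^ b := by
    simp only [Filter.eventually_all_finset]
    exact fun a _ b _ => eventually_mul_ne (h a) _
  have h₅ : ∀ᶠ A : K in Filter.cofinite, ∀ a ∈ range N, ∀ b ∈ range N,
      A ^ 2 * p ^ a ≠ F * p ^ b := by
    simp only [Filter.eventually_all_finset]
    exact fun a _ b _ => eventually_sq_mul_ne (h a) _
  filter_upwards [h₀, h₁, h₂, h₃, h₄, h₅] with A a₀ a₁ a₂ a₃ a₄ a₅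
  exact ⟨a₀, a₁, a₂, a₃, a₄, a₅⟩

theorem qPoch_ne_zero {K : Type*} [Field K] {a q : K} {k : ℕ}
    (h : ∀ j < k, a * q ^ j ≠ 1) : qPoch a q k ≠ 0 :=
  Finset.prod_ne_zero_iff.2 fun j hj => sub_ne_zero.2 (h j (Finset.mem_range.1 hj)).symm

theorem sum_quadTerm_of_genericParam {K : Type*} [Field K] {p F A B : K} (hp : p ≠ 0)
    (hp1 : ∀ j : ℕ, p ^ (j + 1) ≠ 1) (hB : B ≠ 0) (hF : F ≠ 0) (L : ℕ)
    (hA : GenericParam p F B A (3 * L + 10)) (l : ℕ) (hl : l ≤ L) :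
    ∑ k ∈ range (L + 1), quadTerm p F A B (p ^ (2 * l))⁻¹ k =
      (1 - A) * ∏ i ∈ range l, ((1 - A * p ^ (2 * i + 1)) * (1 - A * p ^ (2 * i + 2)) *
        ((A * p ^ (2 * i + 2) - B * F) * (A * B * p ^ (2 * i + 1) - F)) /
        ((A * p ^ (2 * i + 2) - F) * (A * p ^ (2 * i + 1) - F) *
          ((B - A * p ^ (2 * i + 2)) * (1 - A * B * p ^ (2 * i + 1))))) := by
  have hA0 := hA.ne_zero
  have hpw (a : ℕ) : p ^ a ≠ 0 := pow_ne_zero a hp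
  induction l with
  | zero =>
    rw [Finset.sum_range_succ']
    have : ∀ k ∈ range L, quadTerm p F A B (p ^ (2 * 0))⁻¹ (k + 1) = 0 := fun k _ => by
      simp [quadTerm, qPoch_succ_left (1 : K)]
    rw [Finset.sum_eq_zero this]
    simp [quadTerm]
  | succ l ih =>
    obtain ⟨E, hE⟩ : ∃ E : K, E = (p ^ (2 * (l + 1)))⁻¹ := ⟨_, rfl⟩
    have hEp : E * p ^ (2 * (l + 1)) = 1 := by rw [hE, inv_mul_cancel₀ (hpw _)]
    have hE0 : E ≠ 0 := left_ne_zero_of_mul_eq_one hEp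
    have hD : (p ^ (2 * l))⁻¹ = E * p ^ 2 := by
      rw [eq_comm, ← mul_right_inj' (hpw (2 * l)), mul_inv_cancel₀ (hpw _), ← hEp]
      ring
    have hAE : A / (p * E) = A * p ^ (2 * l + 1) := by
      rw [div_eq_iff (mul_ne_zero hp hE0)]
      linear_combination (-A) * hEp
    have hEF : E * F / A * (A * p ^ (2 * (l + 1))) = F := by
      rw [div_mul_eq_mul_div, div_eq_iff hA0]
      linear_combination F * A * hEp
    have hX : 1 - A ^ 2 / (p * E * F) ≠ 0 := by
      rw [sub_ne_zero, ne_comm, Ne, div_eq_one_iff_eq (by simp [hp, hE0, hF])]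
      intro h
      refine hA.sq_ne_F (2 * l + 1) (by simp; omega) 0 (by simp) ?_
      linear_combination p ^ (2 * l + 1) * h + F * hEp
    have hrec := quadTerm_sum_recurrence hp hA0 hB hF hE0 hX L
      (qPoch_ne_zero fun j _ => by
        rw [← pow_succ', ← pow_mul]; exact hp1 (2 * j + 1))
      (qPoch_ne_zero fun j hj h => by
        refine hA.ne_B (2 * j + 2) (by simp; omega) 0 (by simp) ?_
        field_simp at h
        rw [pow_zero, mul_one, ← h]
        ring)
      (qPoch_ne_zero fun j hj h => by
        refine hA.mul_B_ne (2 * j + 1) (by simp; omega) 0 (by simp) ?_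
        rw [pow_zero, ← h]
        ring)
      (qPoch_ne_zero fun j hj h => by
        refine hA.ne_one (2 * l + 1 + j) (by simp; omega) 0 (by simp) ?_
        rw [pow_zero, ← h, hAE]
        ring)
      (qPoch_ne_zero fun j hj h => by
        refine hA.ne_F (j + 1) (by simp; omega) 0 (by simp) ?_
        field_simp at h
        rw [pow_zero, mul_one, ← h]
        ring)
      (qPoch_ne_zero fun j hj h => by
        refine hA.ne_F (2 * (l + 1)) (by simp; omega) j (by simp; omega) ?_
        linear_combination (A * p ^ (2 * (l + 1))) * (-h) + p ^ j * hEF)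
    have hzero : qPoch (E * p ^ 2) (p ^ 2) L = 0 :=
      Finset.prod_eq_zero (Finset.mem_range.2 hl) (by linear_combination -hEp)
    rw [hzero, mul_zero, zero_mul, zero_mul, zero_div, mul_zero, sub_eq_zero, ← hD,
      ih (Nat.le_of_succ_le hl)] at hrec
    rw [← hE, Finset.prod_range_succ]
    have g₁ : A * p ^ (2 * l + 2) - F ≠ 0 := sub_ne_zero.2 fun h =>
      hA.ne_F (2 * l + 2) (by simp; omega) 0 (by simp) (by rw [h, pow_zero, mul_one])
    have g₂ : A * p ^ (2 * l + 1) - F ≠ 0 := sub_ne_zero.2 fun h =>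
      hA.ne_F (2 * l + 1) (by simp; omega) 0 (by simp) (by rw [h, pow_zero, mul_one])
    have g₃ : B - A * p ^ (2 * l + 2) ≠ 0 := sub_ne_zero.2 fun h =>
      hA.ne_B (2 * l + 2) (by simp; omega) 0 (by simp) (by rw [← h, pow_zero, mul_one])
    have g₄ : 1 - A * B * p ^ (2 * l + 1) ≠ 0 := sub_ne_zero.2 fun h =>
      hA.mul_B_ne (2 * l + 1) (by simp; omega) 0 (by simp) (by rw [← h, pow_zero])
    generalize ∑ k ∈ range (L + 1), quadTerm p F A B E k = S at hrec ⊢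
    generalize Finset.prod (range l) (M := K) _ = T at hrec ⊢
    have hEP : E = (p ^ (2 * l + 1) * p)⁻¹ := by rw [hE, ← pow_succ]; rfl
    rw [show p ^ (2 * l + 2) = p ^ (2 * l + 1) * p from pow_succ p _] at g₁ g₃ ⊢
    have hP := hpw (2 * l + 1)
    generalize p ^ (2 * l + 1) = P at *
    rw [mul_div_assoc', mul_div_assoc', eq_div_iff (by simp [g₁, g₂, g₃, g₄])]
    have e₁ : (1 - E * F / A) * (1 - E * F / A * p) *
        ((1 - A / (B * E)) * (1 - A * B / (p * E))) * (A ^ 2 * B * P ^ 2 * p) =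
        (A * (P * p) - F) * (A * P - F) * ((B - A * (P * p)) * (1 - A * B * P)) := by
      rw [hEP]
      field_simp
    have e₂ : (1 - A / (p * E)) * (1 - A / (p * E) * p) *
        ((1 - B * F * E / A) * (1 - F * E * p / (A * B))) * (A ^ 2 * B * P ^ 2 * p) =
        (1 - A * P) * (1 - A * (P * p)) * ((A * (P * p) - B * F) * (A * B * P - F)) := by
      rw [hEP]
      field_simp
    rw [← e₁, ← e₂]
    linear_combination (-(A ^ 2 * B * P ^ 2 * p)) * hrec

/-- Numerator of the ratio of consecutive terms of the quadratic series, cleared of inverses of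
the parameters and without the very-well-poised part. -/
def quadNum {R : Type*} [CommRing R] (p F A B D : R) (j : ℕ) : R :=
  A * (1 - A * p ^ j) * (1 - B * p ^ j) * (B - p ^ (j + 1)) * (1 - D * p ^ (2 * j)) *
    (1 - F * p ^ (2 * j)) * (D * F - A ^ 2 * p ^ (2 * j + 1))

/-- Denominator of the ratio of consecutive terms of the quadratic series, cleared of inverses of
the parameters. -/
def quadDen {R : Type*} [CommRing R] (p F A B D : R) (j : ℕ) : R :=
  (1 - p ^ (2 * j + 2)) * (B - A * p ^ (2 * j + 2)) * (1 - A * B * p ^ (2 * j + 1)) *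
    (D - A * p ^ (j + 1)) * (F - A * p ^ (j + 1)) * (A - D * F * p ^ j)

/-- The quadratic series truncated after the `L`-th term, multiplied by the common denominator. -/
def quadSum {R : Type*} [CommRing R] (p F A B D : R) (L : ℕ) : R :=
  ∑ k ∈ range (L + 1), (1 - A * (p ^ k) ^ 3) * p ^ k *
    ((∏ j ∈ range k, quadNum p F A B D j) * ∏ j ∈ Ico k L, quadDen p F A B D j)

theorem map_quadSum {R S : Type*} [CommRing R] [CommRing S] (φ : R →+* S) (p F A B D : R) (L : ℕ) :
    φ (quadSum p F A B D L) = quadSum (φ p) (φ F) (φ A) (φ B) (φ D) L := by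
  simp [quadSum, quadNum, quadDen, map_sum, map_prod]

theorem quadTerm_eq {K : Type*} [Field K] {p F A B D : K} (hF : F ≠ 0) (hA : A ≠ 0) (hB : B ≠ 0)
    (hD : D ≠ 0) (k : ℕ) :
    quadTerm p F A B D k = (1 - A * (p ^ k) ^ 3) * p ^ k *
      ∏ j ∈ range k, (quadNum p F A B D j / quadDen p F A B D j) := by
  simp only [quadTerm, qPoch, ← Finset.prod_mul_distrib]
  rw [mul_div_assoc, ← Finset.prod_div_distrib]
  congr 1
  refine Finset.prod_congr rfl fun j _ => ?_
  rw [← mul_div_mul_left _ _ (show A * B * D * F ≠ 0 by simp [hA, hB, hD, hF])]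
  congr 1
  · rw [quadNum]
    field_simp
    ring
  · rw [quadDen]
    field_simp
    ring

theorem quadSum_eq {K : Type*} [Field K] {p F A B D : K} (hF : F ≠ 0) (hA : A ≠ 0) (hB : B ≠ 0)
    (hD : D ≠ 0) (L : ℕ) (h : ∀ j < L, quadDen p F A B D j ≠ 0) :
    quadSum p F A B D L =
      (∏ j ∈ range L, quadDen p F A B D j) * ∑ k ∈ range (L + 1), quadTerm p F A B D k := by
  rw [quadSum, Finset.mul_sum]
  refine Finset.sum_congr rfl fun k hk => ?_
  have hk : k ≤ L := Nat.lt_succ_iff.1 (Finset.mem_range.1 hk)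
  rw [quadTerm_eq hF hA hB hD, Finset.prod_div_distrib, ← Finset.prod_range_mul_prod_Ico _ hk]
  have : ∏ j ∈ range k, quadDen p F A B D j ≠ 0 :=
    Finset.prod_ne_zero_iff.2 fun j hj => h j ((Finset.mem_range.1 hj).trans_le hk)
  field_simp

theorem quadSum_eq_mul_of_quadNum_eq_zero {R : Type*} [CommRing R] {p F A B D : R} {M N : ℕ}
    (h0 : quadNum p F A B D N = 0) (hN : N ≤ M) {L : ℕ} (hL : M ≤ L) :
    quadSum p F A B D L = quadSum p F A B D M * ∏ j ∈ Ico M L, quadDen p F A B D j := by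
  induction L, hL using Nat.le_induction with
  | base => simp
  | succ L hL ih =>
    rw [quadSum, Finset.sum_range_succ, Finset.prod_eq_zero (i := N) (by simp; omega) h0, zero_mul,
      mul_zero, add_zero, Finset.prod_Ico_succ_top hL, ← mul_assoc, ← ih, quadSum, Finset.sum_mul]
    refine Finset.sum_congr rfl fun k hk => ?_
    rw [Finset.prod_Ico_succ_top (Nat.lt_succ_iff.1 (Finset.mem_range.1 hk))]
    ring

theorem prod_range_two_mul {R : Type*} [CommRing R] (f : ℕ → R) (L : ℕ) :
    ∏ i ∈ range (2 * L), f i = ∏ l ∈ range L, (f (2 * l) * f (2 * l + 1)) := by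
  induction L with
  | zero => simp
  | succ L ih =>
    rw [show 2 * (L + 1) = 2 * L + 1 + 1 by ring, Finset.prod_range_succ, Finset.prod_range_succ,
      Finset.prod_range_succ, ih, mul_assoc]

/-- The sum of the quadratic series terminating through `D = p ^ (-2L)`, with `A` generic. -/
theorem quadSum_of_genericParam {K : Type*} [Field K] {p F A B : K} (hp : p ≠ 0)
    (hp1 : ∀ j : ℕ, p ^ (j + 1) ≠ 1) (hB : B ≠ 0) (hF : F ≠ 0) (L : ℕ)
    (hA : GenericParam p F B A (3 * L + 10)) :
    quadSum p F A B (p ^ (2 * L))⁻¹ L =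
      (∏ i ∈ range (2 * L + 1), (1 - A * p ^ i)) *
        (∏ l ∈ range L, ((A * p ^ (2 * l + 2) - B * F) * (A * B * p ^ (2 * l + 1) - F))) *
        ∏ j ∈ range L, ((1 - p ^ (2 * j + 2)) * ((p ^ (2 * L))⁻¹ - A * p ^ (j + 1)) *
          -((p ^ (2 * L))⁻¹ * p ^ j)) := by
  have hA0 := hA.ne_zero
  obtain ⟨D, hD⟩ : ∃ D : K, D = (p ^ (2 * L))⁻¹ := ⟨_, rfl⟩
  have hDp : D * p ^ (2 * L) = 1 := by rw [hD, inv_mul_cancel₀ (pow_ne_zero _ hp)]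
  have hD0 : D ≠ 0 := left_ne_zero_of_mul_eq_one hDp
  have g₁ (i : ℕ) (hi : i < 2 * L) : A * p ^ (i + 1) - F ≠ 0 := sub_ne_zero.2 fun h =>
    hA.ne_F (i + 1) (by simp; omega) 0 (by simp) (by rw [h, pow_zero, mul_one])
  have g₃ (l : ℕ) (hl : l < L) : B - A * p ^ (2 * l + 2) ≠ 0 := sub_ne_zero.2 fun h =>
    hA.ne_B (2 * l + 2) (by simp; omega) 0 (by simp) (by rw [← h, pow_zero, mul_one])
  have g₄ (l : ℕ) (hl : l < L) : 1 - A * B * p ^ (2 * l + 1) ≠ 0 := sub_ne_zero.2 fun h =>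
    hA.mul_B_ne (2 * l + 1) (by simp; omega) 0 (by simp) (by rw [← h, pow_zero])
  have g₅ (j : ℕ) (hj : j < L) : D - A * p ^ (j + 1) ≠ 0 := sub_ne_zero.2 fun h =>
    hA.ne_one (2 * L + (j + 1)) (by simp; omega) 0 (by simp) (by
      linear_combination hDp - p ^ (2 * L) * h)
  have g₆ (j : ℕ) (hj : j < L) : A - D * F * p ^ j ≠ 0 := sub_ne_zero.2 fun h =>
    hA.ne_F (2 * L) (by simp; omega) j (by simp; omega) (by
      linear_combination p ^ (2 * L) * h + F * p ^ j * hDp)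
  have hsplit : ∏ l ∈ range L, ((A * p ^ (2 * l + 2) - F) * (A * p ^ (2 * l + 1) - F)) =
      ∏ j ∈ range L, ((A * p ^ (j + 1) - F) * (A * p ^ (2 * L - j) - F)) := by
    have h := prod_range_two_mul (fun i => A * p ^ (i + 1) - F) L
    simp only [mul_comm (A * p ^ (2 * _ + 2) - F)]
    rw [← h, two_mul, Finset.prod_range_add,
      ← Finset.prod_range_reflect (fun i => A * p ^ (L + i + 1) - F) L, ← Finset.prod_mul_distrib]
    refine Finset.prod_congr rfl fun j hj => ?_
    have : L + (L - 1 - j) + 1 = L + L - j := by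
      have := Finset.mem_range.1 hj
      omega
    rw [this]
  have hden : ∏ j ∈ range L, quadDen p F A B D j =
      (∏ l ∈ range L, ((A * p ^ (2 * l + 2) - F) * (A * p ^ (2 * l + 1) - F))) *
      (∏ l ∈ range L, ((B - A * p ^ (2 * l + 2)) * (1 - A * B * p ^ (2 * l + 1)))) *
      ∏ j ∈ range L, ((1 - p ^ (2 * j + 2)) * (D - A * p ^ (j + 1)) * -(D * p ^ j)) := by
    rw [hsplit, ← Finset.prod_mul_distrib, ← Finset.prod_mul_distrib]
    refine Finset.prod_congr rfl fun j hj => ?_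
    have hj' : p ^ j * p ^ (2 * L - j) = p ^ (2 * L) := by
      rw [← pow_add, Nat.add_sub_cancel' (by have := Finset.mem_range.1 hj; omega)]
    rw [quadDen]
    linear_combination (1 - p ^ (2 * j + 2)) * (B - A * p ^ (2 * j + 2)) *
      (1 - A * B * p ^ (2 * j + 1)) * (D - A * p ^ (j + 1)) * (F - A * p ^ (j + 1)) *
      A * (-hDp - D * hj')
  have hodd : ∏ i ∈ range (2 * L + 1), (1 - A * p ^ i) = (1 - A) *
      ∏ i ∈ range L, ((1 - A * p ^ (2 * i + 1)) * (1 - A * p ^ (2 * i + 2))) := by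
    rw [Finset.prod_range_succ', prod_range_two_mul, pow_zero, mul_one, mul_comm]
  have n₁ : ∏ l ∈ range L, ((A * p ^ (2 * l + 2) - F) * (A * p ^ (2 * l + 1) - F)) ≠ 0 :=
    Finset.prod_ne_zero_iff.2 fun l hl => by
      have hl := Finset.mem_range.1 hl
      exact mul_ne_zero (g₁ (2 * l + 1) (by omega)) (g₁ (2 * l) (by omega))
  have n₂ : ∏ l ∈ range L, ((B - A * p ^ (2 * l + 2)) * (1 - A * B * p ^ (2 * l + 1))) ≠ 0 :=
    Finset.prod_ne_zero_iff.2 fun l hl =>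
      mul_ne_zero (g₃ l (Finset.mem_range.1 hl)) (g₄ l (Finset.mem_range.1 hl))
  rw [← hD, quadSum_eq hF hA0 hB hD0 L fun j hj => ?_, hden, hodd]
  · rw [hD, sum_quadTerm_of_genericParam hp hp1 hB hF L hA L le_rfl, Finset.prod_div_distrib]
    simp only [Finset.prod_mul_distrib] at n₁ n₂ ⊢
    rw [mul_div_assoc', mul_div_assoc', div_eq_iff (mul_ne_zero n₁ n₂)]
    ring
  · have g₇ : F - A * p ^ (j + 1) ≠ 0 := by
      rw [← neg_sub]
      exact neg_ne_zero.2 (g₁ j (by omega))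
    simp only [quadDen, mul_ne_zero_iff]
    exact ⟨⟨⟨⟨⟨sub_ne_zero.2 (hp1 (2 * j + 1)).symm, g₃ j hj⟩, g₄ j hj⟩, g₅ j hj⟩, g₇⟩, g₆ j hj⟩

/-- The closed form of `quadSum p F A B D L` when `D = p ^ (-2L)`. -/
def quadProd {R : Type*} [CommRing R] (p F A B D : R) (L : ℕ) : R :=
  (∏ i ∈ range (2 * L + 1), (1 - A * p ^ i)) *
    (∏ l ∈ range L, ((A * p ^ (2 * l + 2) - B * F) * (A * B * p ^ (2 * l + 1) - F))) *
    ∏ j ∈ range L, ((1 - p ^ (2 * j + 2)) * (D - A * p ^ (j + 1)) * -(D * p ^ j))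

theorem map_quadProd {R S : Type*} [CommRing R] [CommRing S] (φ : R →+* S) (p F A B D : R)
    (L : ℕ) : φ (quadProd p F A B D L) = quadProd (φ p) (φ F) (φ A) (φ B) (φ D) L := by
  simp [quadProd, map_prod]

open Polynomial in
/-- The sum of the quadratic series terminating through `D = p ^ (-2L)`. -/
theorem quadSum_eq_quadProd {K : Type*} [Field K] [Infinite K] {p F : K} (hp : p ≠ 0)
    (hp1 : ∀ j : ℕ, p ^ (j + 1) ≠ 1) (hF : F ≠ 0) (A : K) {B : K} (hB : B ≠ 0) (L : ℕ) :
    quadSum p F A B (p ^ (2 * L))⁻¹ L = quadProd p F A B (p ^ (2 * L))⁻¹ L := by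
  have h : quadSum (C p) (C F) X (C B) (C (p ^ (2 * L))⁻¹) L =
      quadProd (C p) (C F) X (C B) (C (p ^ (2 * L))⁻¹) L := by
    refine eq_of_infinite_eval_eq _ _ ?_
    have hgen := eventually_genericParam (F := F) hp hB (3 * L + 10)
    refine Filter.frequently_cofinite_iff_infinite.1 (hgen.mono fun A hA => ?_).frequently
    rw [← coe_evalRingHom, map_quadSum, map_quadProd]
    simp only [coe_evalRingHom, eval_C, eval_X]
    exact quadSum_of_genericParam hp hp1 hB hF L hA
  have := congrArg (evalRingHom A) h
  rw [map_quadSum, map_quadProd] at this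
  simpa using this

theorem pow_right_injective_of_pow_ne_one {K : Type*} [Field K] {p : K} (hp : p ≠ 0)
    (hp1 : ∀ j : ℕ, p ^ (j + 1) ≠ 1) : Function.Injective fun a : ℕ => p ^ a := by
  intro a b h
  wlog hab : a ≤ b generalizing a b
  · exact (this h.symm (by omega)).symm
  obtain ⟨c, rfl⟩ := Nat.exists_eq_add_of_le hab
  cases c with
  | zero => rfl
  | succ c =>
    have h : p ^ a = p ^ (a + (c + 1)) := h
    rw [pow_add, eq_comm, mul_eq_left₀ (pow_ne_zero a hp)] at h
    exact absurd h (hp1 c)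

open Polynomial in
/-- The quadratic series terminating through `A = p ^ (-N)` vanishes. -/
theorem quadSum_eq_zero_of_left {K : Type*} [Field K] [Infinite K] {p F B : K} (hp : p ≠ 0)
    (hp1 : ∀ j : ℕ, p ^ (j + 1) ≠ 1) (hF : F ≠ 0) (hF' : ∀ a b : ℕ, F * p ^ a ≠ p ^ b)
    (hB : B ≠ 0) {N M : ℕ} (hNM : N ≤ M) (hB₁ : ∀ j : ℕ, B * p ^ N ≠ p ^ (2 * j + 2))
    (hB₂ : ∀ j : ℕ, B * p ^ (2 * j + 1) ≠ p ^ N) (D : K) :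
    quadSum p F (p ^ N)⁻¹ B D M = 0 := by
  have hinj := pow_right_injective_of_pow_ne_one hp hp1
  obtain ⟨A, hA⟩ : ∃ A : K, A = (p ^ N)⁻¹ := ⟨_, rfl⟩
  have hAp : A * p ^ N = 1 := by rw [hA, inv_mul_cancel₀ (pow_ne_zero _ hp)]
  rw [← hA]
  have h : quadSum (C p) (C F) (C A) (C B) X M = 0 := by
    refine eq_zero_of_infinite_isRoot _ (Set.infinite_of_injective_forall_mem
      (f := fun L : ℕ => (p ^ (2 * (M + L)))⁻¹) (fun a b h => ?_) fun L => ?_)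
    · have := hinj (inv_injective h)
      omega
    · obtain ⟨D, hD⟩ : ∃ D : K, D = (p ^ (2 * (M + L)))⁻¹ := ⟨_, rfl⟩
      have hDp : D * p ^ (2 * (M + L)) = 1 := by rw [hD, inv_mul_cancel₀ (pow_ne_zero _ hp)]
      have h0 : quadNum p F A B D N = 0 := by
        rw [quadNum, hAp]
        ring
      have hext := quadSum_eq_mul_of_quadNum_eq_zero h0 hNM (Nat.le_add_right M L)
      rw [hD, quadSum_eq_quadProd hp hp1 hF A hB, quadProd,
        Finset.prod_eq_zero (i := N) (by simp; omega) (by rw [hAp, sub_self]), zero_mul, zero_mul,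
        ← hD, eq_comm, mul_eq_zero, Finset.prod_eq_zero_iff] at hext
      rw [Set.mem_ofPred_eq, IsRoot.def, ← coe_evalRingHom, map_quadSum]
      simp only [coe_evalRingHom, eval_C, eval_X, ← hD]
      refine hext.resolve_right ?_
      rintro ⟨j, hj, hj0⟩
      rw [Finset.mem_Ico] at hj
      simp only [quadDen, mul_eq_zero, sub_eq_zero] at hj0
      obtain ((((h | h) | h) | h) | h) | h := hj0
      · exact hp1 (2 * j + 1) h.symm
      · refine hB₁ j ?_
        linear_combination p ^ N * h + p ^ (2 * j + 2) * hAp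
      · refine hB₂ j ?_
        linear_combination (-p ^ N) * h - B * p ^ (2 * j + 1) * hAp
      · have : p ^ N = p ^ (2 * (M + L) + (j + 1)) := by
          linear_combination p ^ N * p ^ (2 * (M + L)) * h - p ^ N * hDp +
            p ^ (j + 1) * p ^ (2 * (M + L)) * hAp
        have := hinj this
        omega
      · refine hF' N (j + 1) ?_
        linear_combination p ^ N * h + p ^ (j + 1) * hAp
      · refine hF' (j + N) (2 * (M + L)) ?_
        linear_combination (-p ^ N * p ^ (2 * (M + L))) * h + p ^ (2 * (M + L)) * hAp -
          F * p ^ j * p ^ N * hDp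
  have := congrArg (evalRingHom D) h
  rw [map_quadSum] at this
  simpa using this

open Polynomial in
/-- The quadratic series with `A = D`, terminating through `B = p ^ (-N)` with `N` odd,
vanishes. -/
theorem quadSum_eq_zero_of_right {K : Type*} [Field K] [Infinite K] {p F : K} (hp : p ≠ 0)
    (hp1 : ∀ j : ℕ, p ^ (j + 1) ≠ 1) (hF : F ≠ 0) (hF' : ∀ a b : ℕ, F * p ^ a ≠ p ^ b)
    {N M : ℕ} (hN : Odd N) (hNM : N ≤ M) (A : K) : quadSum p F A (p ^ N)⁻¹ A M = 0 := by
  have hinj := pow_right_injective_of_pow_ne_one hp hp1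
  obtain ⟨B, hB⟩ : ∃ B : K, B = (p ^ N)⁻¹ := ⟨_, rfl⟩
  have hBp : B * p ^ N = 1 := by rw [hB, inv_mul_cancel₀ (pow_ne_zero _ hp)]
  have hB0 : B ≠ 0 := left_ne_zero_of_mul_eq_one hBp
  rw [← hB]
  have h : quadSum (C p) (C F) X (C B) X M = 0 := by
    refine eq_zero_of_infinite_isRoot _ (Set.infinite_of_injective_forall_mem
      (f := fun L : ℕ => (p ^ (2 * (M + L)))⁻¹) (fun a b h => ?_) fun L => ?_)
    · have := hinj (inv_injective h)
      omega
    · obtain ⟨D, hD⟩ : ∃ D : K, D = (p ^ (2 * (M + L)))⁻¹ := ⟨_, rfl⟩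
      have hDp : D * p ^ (2 * (M + L)) = 1 := by rw [hD, inv_mul_cancel₀ (pow_ne_zero _ hp)]
      have hD0 : D ≠ 0 := left_ne_zero_of_mul_eq_one hDp
      have h0 : quadNum p F D B D N = 0 := by
        rw [quadNum, hBp]
        ring
      have hext := quadSum_eq_mul_of_quadNum_eq_zero h0 hNM (Nat.le_add_right M L)
      have hzero : quadSum p F D B D (M + L) = 0 := by
        have := quadSum_eq_quadProd hp hp1 hF D hB0 (M + L)
        rw [← hD, quadProd, Finset.prod_eq_zero (i := 2 * (M + L)) (by simp)
          (by rw [hDp, sub_self]), zero_mul, zero_mul] at this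
        exact this
      rw [hzero, eq_comm, mul_eq_zero, Finset.prod_eq_zero_iff] at hext
      rw [Set.mem_ofPred_eq, IsRoot.def, ← coe_evalRingHom, map_quadSum]
      simp only [coe_evalRingHom, eval_C, eval_X, ← hD]
      refine hext.resolve_right ?_
      rintro ⟨j, hj, hj0⟩
      rw [Finset.mem_Ico] at hj
      simp only [quadDen, mul_eq_zero, sub_eq_zero] at hj0
      obtain ⟨r, rfl⟩ := hN
      obtain ((((h | h) | h) | h) | h) | h := hj0
      · exact hp1 (2 * j + 1) h.symm
      · have : p ^ (2 * (M + L)) = p ^ (2 * r + 1 + (2 * j + 2)) := by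
          linear_combination p ^ (2 * r + 1) * p ^ (2 * (M + L)) * h -
            p ^ (2 * (M + L)) * hBp + p ^ (2 * r + 1) * p ^ (2 * j + 2) * hDp
        have := hinj this
        omega
      · have : p ^ (2 * r + 1 + 2 * (M + L)) = p ^ (2 * j + 1) := by
          linear_combination p ^ (2 * r + 1) * p ^ (2 * (M + L)) * h +
            p ^ (2 * j + 1) * D * p ^ (2 * (M + L)) * hBp + p ^ (2 * j + 1) * hDp
        have := hinj this
        omega
      · refine hp1 j (mul_left_cancel₀ hD0 ?_)
        rw [← h, mul_one]
      · refine hF' (2 * (M + L)) (j + 1) ?_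
        linear_combination p ^ (2 * (M + L)) * h + p ^ (j + 1) * hDp
      · refine hF' j 0 (mul_left_cancel₀ hD0 ?_)
        rw [pow_zero, mul_one, ← mul_assoc, ← h]
  have := congrArg (evalRingHom A) h
  rw [map_quadSum] at this
  simpa using this

theorem dvd_sub_of_quotient_mk_eq {R : Type*} [CommRing R] {π x y : R}
    (h : Ideal.Quotient.mk (Ideal.span {π}) x = Ideal.Quotient.mk (Ideal.span {π}) y) :
    π ∣ x - y := by
  rwa [Ideal.Quotient.mk_eq_mk_iff_sub_mem, Ideal.mem_span_singleton] at h

theorem quotient_mk_eq_of_dvd_sub {R : Type*} [CommRing R] {π x y : R} (h : π ∣ x - y) :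
    Ideal.Quotient.mk (Ideal.span {π}) x = Ideal.Quotient.mk (Ideal.span {π}) y := by
  rwa [Ideal.Quotient.mk_eq_mk_iff_sub_mem, Ideal.mem_span_singleton]

theorem dvd_quadSum_sub {R : Type*} [CommRing R] {π D D' : R} (hD : π ∣ D - D') (p F A B : R)
    (L : ℕ) : π ∣ quadSum p F A B D L - quadSum p F A B D' L := by
  apply dvd_sub_of_quotient_mk_eq
  rw [map_quadSum, map_quadSum, quotient_mk_eq_of_dvd_sub hD]

open Polynomial in
theorem sq_dvd_quadSum_sub {R : Type*} [CommRing R] {π B B' D D' : R} (hB : π ∣ B - B')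
    (hD : π ∣ D - D') (p F A : R) (L : ℕ) :
    π ^ 2 ∣ (quadSum p F A B D L - quadSum p F A B D' L) -
      (quadSum p F A B' D L - quadSum p F A B' D' L) := by
  have hD' : C π ∣ C D - C D' := by
    rw [← C_sub]
    exact map_dvd C hD
  obtain ⟨k, hk⟩ := dvd_quadSum_sub hD' (C p) (C F) (C A) X L
  have h (x : R) : quadSum p F A x D L - quadSum p F A x D' L = π * k.eval x := by
    have := congrArg (evalRingHom x) hk
    rw [map_sub, map_quadSum, map_quadSum] at this
    simpa using this
  rw [h, h, ← mul_sub, sq]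
  exact mul_dvd_mul_left π (hB.trans (sub_dvd_eval_sub B B' k))

open Polynomial in
theorem cube_dvd_quadSum_sub {R : Type*} [CommRing R] {π A A' B B' D D' : R} (hA : π ∣ A - A')
    (hB : π ∣ B - B') (hD : π ∣ D - D') (p F : R) (L : ℕ) :
    π ^ 3 ∣ ((quadSum p F A B D L - quadSum p F A B D' L) -
        (quadSum p F A B' D L - quadSum p F A B' D' L)) -
      ((quadSum p F A' B D L - quadSum p F A' B D' L) -
        (quadSum p F A' B' D L - quadSum p F A' B' D' L)) := by
  have hB' : C π ∣ C B - C B' := by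
    rw [← C_sub]
    exact map_dvd C hB
  have hD' : C π ∣ C D - C D' := by
    rw [← C_sub]
    exact map_dvd C hD
  obtain ⟨k, hk⟩ := sq_dvd_quadSum_sub hB' hD' (C p) (C F) X L
  have h (x : R) : (quadSum p F x B D L - quadSum p F x B D' L) -
      (quadSum p F x B' D L - quadSum p F x B' D' L) = π ^ 2 * k.eval x := by
    have := congrArg (evalRingHom x) hk
    simp only [map_sub, map_quadSum] at this
    simpa using this
  rw [h, h, ← mul_sub, pow_succ]
  exact mul_dvd_mul_left (π ^ 2) (hA.trans (sub_dvd_eval_sub A A' k))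

theorem cube_dvd_quadProd_sub {R : Type*} [CommRing R] {π p A B B' : R} {i j L : ℕ} (hij : i ≠ j)
    (hiL : i ≤ 2 * L) (hjL : j ≤ 2 * L) (hi : π ∣ 1 - A * p ^ i) (hj : π ∣ 1 - A * p ^ j)
    (hB : π ∣ B - B') (F D : R) :
    π ^ 3 ∣ quadProd p F A B D L - quadProd p F A B' D L := by
  have h₁ : π ^ 2 ∣ ∏ i ∈ range (2 * L + 1), (1 - A * p ^ i) := by
    rw [← Finset.mul_prod_erase _ _ (Finset.mem_range.2 (Nat.lt_succ_of_le hiL)),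
      ← Finset.mul_prod_erase _ _
        (Finset.mem_erase.2 ⟨hij.symm, Finset.mem_range.2 (Nat.lt_succ_of_le hjL)⟩), sq]
    exact mul_dvd_mul hi (hj.mul_right _)
  have h₂ : π ∣ ∏ l ∈ range L, ((A * p ^ (2 * l + 2) - B * F) * (A * B * p ^ (2 * l + 1) - F)) -
      ∏ l ∈ range L, ((A * p ^ (2 * l + 2) - B' * F) * (A * B' * p ^ (2 * l + 1) - F)) := by
    apply dvd_sub_of_quotient_mk_eq
    simp only [map_prod, map_mul, map_sub, quotient_mk_eq_of_dvd_sub hB]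
  rw [quadProd, quadProd, ← sub_mul, ← mul_sub, pow_succ]
  exact (mul_dvd_mul h₁ h₂).mul_right _

/-- If `π` divides the deformations `A - A'`, `B - B'`, `D - D'` and the quadratic series vanishes
or has a product formula at the deformed parameters, then `π ^ 3` divides the undeformed series. -/
theorem cube_dvd_quadSum {R : Type*} [CommRing R] {π p F A A' B B' D D' : R} {i j L : ℕ}
    (hA : π ∣ A - A') (hB : π ∣ B - B') (hD : π ∣ D - D')
    (hleft : ∀ b ∈ ({B, B'} : Set R), ∀ x : R, quadSum p F A' b x L = 0)
    (hright : quadSum p F A B' D L = 0)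
    (hprod : ∀ b ∈ ({B, B'} : Set R), quadSum p F A b D' L = quadProd p F A b D' L)
    (hij : i ≠ j) (hiL : i ≤ 2 * L) (hjL : j ≤ 2 * L) (hi : π ∣ 1 - A * p ^ i)
    (hj : π ∣ 1 - A * p ^ j) :
    π ^ 3 ∣ quadSum p F A B D L := by
  have h₁ := cube_dvd_quadSum_sub hA hB hD p F L
  have h₂ := cube_dvd_quadProd_sub hij hiL hjL hi hj hB F D'
  rw [hleft B (by simp), hleft B (by simp), hleft B' (by simp), hleft B' (by simp), hright,
    hprod B (by simp), hprod B' (by simp)] at h₁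
  convert dvd_add h₁ h₂ using 1
  ring

theorem ev_ne_zero : ev ≠ 0 := by
  simp [ev]

theorem qv_ne_zero : qv ≠ 0 := by
  simp [qv]

theorem algebraMap_R2_injective : Function.Injective (algebraMap R2 K2) :=
  IsFractionRing.injective R2 K2

theorem qv_pow_succ_ne_one (j : ℕ) : qv ^ (j + 1) ≠ 1 := by
  intro h
  rw [qv, ← map_pow, ← map_one (algebraMap R2 K2)] at h
  simpa using congrArg (MvPolynomial.eval fun _ => (0 : ℚ)) (algebraMap_R2_injective h)

theorem ev_mul_qv_pow_ne (a b : ℕ) : ev * qv ^ a ≠ qv ^ b := by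
  intro h
  rw [qv, ev, ← map_pow, ← map_pow, ← map_mul] at h
  simpa using congrArg (MvPolynomial.eval (![1, 0] : Fin 2 → ℚ)) (algebraMap_R2_injective h)

theorem Phi2_prime {n : ℕ} (hn : 0 < n) : Prime (Phi2 n) := by
  have h : Phi2 n = MvPolynomial.rename ((↑) : ({0} : Set (Fin 2)) → Fin 2)
      ((MvPolynomial.uniqueAlgEquiv ℚ ({0} : Set (Fin 2))).symm (Polynomial.cyclotomic n ℚ)) := by
    have : (MvPolynomial.rename ((↑) : ({0} : Set (Fin 2)) → Fin 2)).comp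
        (MvPolynomial.uniqueAlgEquiv ℚ ({0} : Set (Fin 2))).symm.toAlgHom =
        Polynomial.aeval (MvPolynomial.X 0 : R2) :=
      Polynomial.algHom_ext (by simp)
    rw [Phi2, ← this]
    rfl
  rw [h, MvPolynomial.prime_rename_iff, MulEquiv.prime_iff]
  exact (Polynomial.cyclotomic.irreducible_rat hn).prime

theorem Phi2_dvd_one_sub {n m : ℕ} (h : n ∣ m) : Phi2 n ∣ 1 - MvPolynomial.X 0 ^ m := by
  have h₁ : Polynomial.cyclotomic n ℚ ∣ 1 - Polynomial.X ^ m := by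
    rw [← neg_sub, dvd_neg]
    obtain ⟨k, rfl⟩ := h
    refine (Polynomial.cyclotomic.dvd_X_pow_sub_one n ℚ).trans ?_
    rw [pow_mul]
    simpa using sub_dvd_pow_sub_pow (Polynomial.X ^ n : Polynomial ℚ) 1 k
  simpa [Phi2] using map_dvd (Polynomial.aeval (MvPolynomial.X 0 : R2)) h₁

theorem aeval_Phi2 {n : ℕ} (hn : 0 < n) {ζ : ℂ} (hζ : IsPrimitiveRoot ζ n) :
    MvPolynomial.aeval ![ζ, 0] (Phi2 n) = 0 := by
  rw [Phi2, ← Polynomial.aeval_algHom_apply]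
  have := hζ.isRoot_cyclotomic hn
  rw [← Polynomial.map_cyclotomic n (algebraMap ℚ ℂ), Polynomial.IsRoot.def,
    Polynomial.eval_map_algebraMap] at this
  simpa using this

/-- Rational functions whose denominator is a power of `q`. -/
def qLaurent : Subring K2 where
  carrier := {x | ∃ (f : R2) (k : ℕ), x * qv ^ k = algebraMap R2 K2 f}
  mul_mem' := by
    rintro x y ⟨f, k, hf⟩ ⟨g, l, hg⟩
    exact ⟨f * g, k + l, by rw [map_mul, ← hf, ← hg]; ring⟩
  one_mem' := ⟨1, 0, by simp⟩
  add_mem' := by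
    rintro x y ⟨f, k, hf⟩ ⟨g, l, hg⟩
    refine ⟨f * MvPolynomial.X 0 ^ l + g * MvPolynomial.X 0 ^ k, k + l, ?_⟩
    rw [map_add, map_mul, map_mul, map_pow, map_pow, ← hf, ← hg, qv]
    ring
  zero_mem' := ⟨0, 0, by simp⟩
  neg_mem' := by
    rintro x ⟨f, k, hf⟩
    exact ⟨-f, k, by rw [map_neg, ← hf]; ring⟩

theorem algebraMap_mem_qLaurent (f : R2) : algebraMap R2 K2 f ∈ qLaurent :=
  ⟨f, 0, by simp⟩

theorem inv_qv_mem_qLaurent : qv⁻¹ ∈ qLaurent :=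
  ⟨1, 1, by simp [qv_ne_zero]⟩

/-- A congruence modulo a power of `Φ_n` from a factorisation whose cofactor does not vanish at a
primitive root of unity. -/
theorem congrMod2_zero_of_mul_eq {n r : ℕ} (hn : 0 < n) {ζ : ℂ} (hζ : IsPrimitiveRoot ζ n) {S : K2}
    {f g : R2} (hg : MvPolynomial.aeval ![ζ, 0] g ≠ 0)
    (h : S * algebraMap R2 K2 g = algebraMap R2 K2 (Phi2 n ^ r) * algebraMap R2 K2 f) :
    CongrMod2 S 0 (Phi2 n ^ r) := by
  refine ⟨f, g, fun h0 => hg (by rw [h0, map_zero]), fun x hx hxg hxΦ => hg ?_, by rwa [sub_zero]⟩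
  have hΦ := (hx.irreducible.associated_of_dvd (Phi2_prime hn).irreducible (hx.dvd_of_dvd_pow hxΦ))
  obtain ⟨c, rfl⟩ := hΦ.dvd'.trans hxg
  rw [map_mul, aeval_Phi2 hn hζ, zero_mul]

theorem not_dvd_two_mul_mul {t m M j : ℕ} (ht : 0 < t) (hM : M = 2 * t * m + t + m + 1)
    (hj : j < M) (k : ℕ) (hk : k = 1 ∨ k = 2) :
    ¬ 2 * t * (2 * m + 1) + 1 ∣ 2 * t * (k * (j + 1)) := by
  intro h
  have hc : Nat.Coprime (2 * t * (2 * m + 1) + 1) (2 * t) := by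
    simp
  have hc2 : Nat.Coprime (2 * t * (2 * m + 1) + 1) k := by
    obtain rfl | rfl := hk
    · exact Nat.coprime_one_right _
    · exact Nat.Coprime.coprime_mul_right_right hc
  have := Nat.le_of_dvd (Nat.succ_pos j) (hc2.dvd_of_dvd_mul_left (hc.dvd_of_dvd_mul_left h))
  nlinarith [Nat.zero_le (t * m), Nat.mul_le_mul_right m ht]

theorem not_dvd_two_add {t m M j : ℕ} (ht : 0 < t) (hM : M = 2 * t * m + t + m + 1) (hj : j < M) :
    ¬ 2 * t * (2 * m + 1) + 1 ∣ 2 + 2 * t * (2 * j + 1) := by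
  intro h
  have hc : Nat.Coprime (2 * t * (2 * m + 1) + 1) 2 :=
    Nat.Coprime.coprime_mul_right_right (k := t) (by simp)
  rw [show 2 + 2 * t * (2 * j + 1) = 2 * (1 + t * (2 * j + 1)) by ring] at h
  obtain ⟨k, hk⟩ := hc.dvd_of_dvd_mul_left h
  have ht' : (t : ℤ) ≠ 0 := by positivity
  zify at hk hj hM
  obtain ⟨s, hs⟩ : (t : ℤ) ∣ k - 1 :=
    ⟨2 * j + 1 - 2 * (2 * m + 1) * k, by linear_combination -hk⟩
  have hs' : (2 * j + 1 : ℤ) = 2 * (2 * m + 1) + s * (2 * t * (2 * m + 1) + 1) := by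
    refine mul_left_cancel₀ ht' ?_
    linear_combination hk + (2 * t * (2 * m + 1) + 1) * hs
  have hs0 : 0 ≤ s := by
    by_contra! hneg
    have : (0 : ℤ) ≤ k := by positivity
    have : (k : ℤ) ≠ 0 := by
      rintro h0
      rw [h0] at hk
      have : (0 : ℤ) < 1 + t * (2 * j + 1) := by positivity
      omega
    have : (1 : ℤ) ≤ k := by omega
    nlinarith
  have hs1 : s ≠ 0 := by
    rintro rfl
    omega
  have hs2 : 1 ≤ s := by omega
  have : (2 * t * (2 * m + 1) + 1 : ℤ) ≤ s * (2 * t * (2 * m + 1) + 1) :=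
    le_mul_of_one_le_left (by positivity) hs2
  nlinarith

theorem map_quadDen {R S : Type*} [CommRing R] [CommRing S] (φ : R →+* S) (p F A B D : R) (j : ℕ) :
    φ (quadDen p F A B D j) = quadDen (φ p) (φ F) (φ A) (φ B) (φ D) j := by
  simp [quadDen]

theorem quadDen_primitiveRoot_ne_zero {t m M j n : ℕ} (ht : 0 < t) (hM : M = 2 * t * m + t + m + 1)
    (hj : j < M) (hn : n = 2 * t * (2 * m + 1) + 1) {ζ : ℂ} (hζ : IsPrimitiveRoot ζ n) :
    quadDen (ζ ^ (2 * t)) 0 ζ ζ ζ j ≠ 0 := by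
  have hζ0 : ζ ≠ 0 := hζ.ne_zero (by omega)
  have h₁ : (ζ ^ (2 * t)) ^ (2 * j + 2) ≠ 1 := by
    rw [← pow_mul, Ne, hζ.pow_eq_one_iff_dvd, hn]
    exact not_dvd_two_mul_mul ht hM hj 2 (Or.inr rfl)
  have h₂ : (ζ ^ (2 * t)) ^ (j + 1) ≠ 1 := by
    rw [← pow_mul, Ne, hζ.pow_eq_one_iff_dvd, hn, ← one_mul (j + 1)]
    exact not_dvd_two_mul_mul ht hM hj 1 (Or.inl rfl)
  have h₃ : ζ * ζ * (ζ ^ (2 * t)) ^ (2 * j + 1) ≠ 1 := by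
    rw [← sq, ← pow_mul, ← pow_add, Ne, hζ.pow_eq_one_iff_dvd, hn]
    exact not_dvd_two_add ht hM hj
  simp only [quadDen, mul_ne_zero_iff, sub_ne_zero]
  refine ⟨⟨⟨⟨⟨h₁.symm, ?_⟩, h₃.symm⟩, ?_⟩, ?_⟩, ?_⟩
  · simpa [eq_comm, hζ0] using h₁
  · simpa [eq_comm, hζ0] using h₂
  · exact (mul_ne_zero hζ0 (pow_ne_zero _ (pow_ne_zero _ hζ0))).symm
  · simp [hζ0]

theorem quadSum_congruence {t m M n : ℕ} (ht : 0 < t) (hM : M = 2 * t * m + t + m + 1)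
    (hn : n = 2 * t * (2 * m + 1) + 1) :
    ∃ (f : R2) (k : ℕ), quadSum (qv ^ (2 * t)) ev qv qv qv M * qv ^ k =
      algebraMap R2 K2 (Phi2 n ^ 3) * algebraMap R2 K2 f := by
  let q' : qLaurent := ⟨qv, algebraMap_mem_qLaurent _⟩
  let e' : qLaurent := ⟨ev, algebraMap_mem_qLaurent _⟩
  let r' : qLaurent := ⟨qv⁻¹, inv_qv_mem_qLaurent⟩
  let π' : qLaurent := ⟨algebraMap R2 K2 (Phi2 n), algebraMap_mem_qLaurent _⟩
  have hqr : q' * r' = 1 := Subtype.ext (mul_inv_cancel₀ qv_ne_zero)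
  have hdvd {a : ℕ} (ha : n ∣ a) : π' ∣ 1 - q' ^ a := by
    obtain ⟨c, hc⟩ := Phi2_dvd_one_sub ha
    refine ⟨⟨algebraMap R2 K2 c, algebraMap_mem_qLaurent _⟩, Subtype.ext ?_⟩
    have := congrArg (algebraMap R2 K2) hc
    rw [map_mul, map_sub, map_one, map_pow] at this
    exact this
  have hdvd' {a : ℕ} (ha : n ∣ a) : π' ∣ q' - q' * r' ^ a := by
    have h : q' ^ a * r' ^ a = 1 := by rw [← mul_pow, hqr, one_pow]
    have : q' - q' * r' ^ a = (1 - q' ^ a) * (-(q' * r' ^ a)) := by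
      linear_combination (-q') * h
    rw [this]
    exact (hdvd ha).mul_right _
  have hp : qv ^ (2 * t) ≠ 0 := pow_ne_zero _ qv_ne_zero
  have hq1 := qv_pow_succ_ne_one
  have hinj := pow_right_injective_of_pow_ne_one qv_ne_zero hq1
  have hp1 (j : ℕ) : (qv ^ (2 * t)) ^ (j + 1) ≠ 1 := by
    rw [← pow_mul]
    intro h
    have := hinj (h.trans (pow_zero qv).symm)
    simp at this
    omega
  have hF' (a b : ℕ) : ev * (qv ^ (2 * t)) ^ a ≠ (qv ^ (2 * t)) ^ b := by
    rw [← pow_mul, ← pow_mul]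
    exact ev_mul_qv_pow_ne _ _
  have hAv : ((q' * r' ^ n : qLaurent) : K2) = ((qv ^ (2 * t)) ^ (2 * m + 1))⁻¹ := by
    change qv * qv⁻¹ ^ n = _
    rw [← pow_mul, hn, pow_succ', ← mul_assoc, mul_inv_cancel₀ qv_ne_zero, one_mul, inv_pow]
  have hDv : ((q' * r' ^ (2 * t * (2 * M) + 1) : qLaurent) : K2) =
      ((qv ^ (2 * t)) ^ (2 * M))⁻¹ := by
    change qv * qv⁻¹ ^ (2 * t * (2 * M) + 1) = _
    rw [← pow_mul, pow_succ', ← mul_assoc, mul_inv_cancel₀ qv_ne_zero, one_mul, inv_pow]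
  have hNM : 2 * m + 1 ≤ M := by nlinarith [Nat.mul_le_mul_right m ht]
  have hnM : n ∣ 2 * t * (2 * M) + 1 := ⟨2 * t + 1, by rw [hn, hM]; ring⟩
  have hmod (a b : ℕ) : 2 * t * a + 1 ≠ 2 * t * b := fun h => by
    have := (Nat.dvd_add_right (Dvd.intro a rfl : 2 * t ∣ 2 * t * a)).1 (h ▸ Dvd.intro b rfl)
    have := Nat.le_of_dvd one_pos this
    omega
  have hsum (A B D : qLaurent) : ((quadSum (q' ^ (2 * t)) e' A B D M : qLaurent) : K2) =
      quadSum (qv ^ (2 * t)) ev A B D M :=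
    map_quadSum qLaurent.subtype _ _ _ _ _ _
  have hprod (A B D : qLaurent) : ((quadProd (q' ^ (2 * t)) e' A B D M : qLaurent) : K2) =
      quadProd (qv ^ (2 * t)) ev A B D M :=
    map_quadProd qLaurent.subtype _ _ _ _ _ _
  have hBv : ∀ b ∈ ({q', q' * r' ^ n} : Set qLaurent), (b : K2) ≠ 0 ∧
      (∀ j : ℕ, (b : K2) * (qv ^ (2 * t)) ^ (2 * m + 1) ≠ (qv ^ (2 * t)) ^ (2 * j + 2)) ∧
      ∀ j : ℕ, (b : K2) * (qv ^ (2 * t)) ^ (2 * j + 1) ≠ (qv ^ (2 * t)) ^ (2 * m + 1) := by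
    rintro b (rfl | rfl)
    · refine ⟨qv_ne_zero, fun j h => ?_, fun j h => ?_⟩ <;>
      · simp only [q', ← pow_mul, ← pow_succ'] at h
        exact hmod _ _ (hinj h)
    · rw [hAv]
      refine ⟨inv_ne_zero (pow_ne_zero _ hp), fun j h => ?_, fun j h => ?_⟩
      · rw [inv_mul_cancel₀ (pow_ne_zero _ hp)] at h
        exact hp1 _ h.symm
      · rw [inv_mul_eq_iff_eq_mul₀ (pow_ne_zero _ hp), ← pow_add] at h
        have := pow_right_injective_of_pow_ne_one hp hp1 h
        omega
  obtain ⟨y, hy⟩ : π' ^ 3 ∣ quadSum (q' ^ (2 * t)) e' q' q' q' M := by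
    refine cube_dvd_quadSum (A' := q' * r' ^ n) (B' := q' * r' ^ n)
      (D' := q' * r' ^ (2 * t * (2 * M) + 1)) (i := 2 * m + 1) (j := 2 * M) (hdvd' dvd_rfl)
      (hdvd' dvd_rfl) (hdvd' hnM) (fun b hb x => Subtype.ext ?_) (Subtype.ext ?_)
      (fun b hb => Subtype.ext ?_) (by omega) (by omega) le_rfl ?_ ?_
    · obtain ⟨h₀, h₁, h₂⟩ := hBv b hb
      rw [hsum, hAv]
      exact quadSum_eq_zero_of_left hp hp1 ev_ne_zero hF' h₀ hNM h₁ h₂ x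
    · rw [hsum, hAv]
      exact quadSum_eq_zero_of_right hp hp1 ev_ne_zero hF' ⟨m, rfl⟩ hNM qv
    · rw [hsum, hprod, hDv]
      exact quadSum_eq_quadProd hp hp1 ev_ne_zero _ (hBv b hb).1 M
    · rw [← pow_mul, ← pow_succ', ← hn]
      exact hdvd dvd_rfl
    · rw [← pow_mul, ← pow_succ']
      exact hdvd hnM
  obtain ⟨f, k, hf⟩ := y.2
  refine ⟨f, k, ?_⟩
  have := congrArg (Subtype.val) hy
  rw [hsum] at this
  rw [this, ← hf, map_pow]
  change algebraMap R2 K2 (Phi2 n) ^ 3 * (y : K2) * qv ^ k = _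
  ring

theorem summand_eq_quadTerm {d : ℕ} (hd : 0 < d) (k : ℕ) :
    qInt qv (3 * (d : ℤ) * k + 1) *
          (qPoch qv (qv ^ (2 * d)) k * qPoch ev (qv ^ (2 * d)) k *
            qPoch (qv ^ (1 + d) / ev) (qv ^ (2 * d)) k) *
          (qPoch qv (qv ^ d) k * qPoch qv (qv ^ d) k * qPoch (qv ^ (d - 1)) (qv ^ d) k) /
          (qPoch (qv ^ d) (qv ^ d) k * qPoch ev (qv ^ d) k *
            qPoch (qv ^ (1 + d) / ev) (qv ^ d) k *
            (qPoch (qv ^ (2 * d)) (qv ^ (2 * d)) k * qPoch (qv ^ (2 * d)) (qv ^ (2 * d)) k *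
              qPoch (qv ^ (d + 2)) (qv ^ (2 * d)) k)) *
          qv ^ (d * k) =
      quadTerm (qv ^ d) ev qv qv qv k / (1 - qv) := by
  have hq := qv_ne_zero
  have he := ev_ne_zero
  have e₁ : qv ^ (2 * d) = (qv ^ d) ^ 2 := by rw [← pow_mul, mul_comm]
  have e₂ : qv ^ (1 + d) / ev = qv * qv ^ d / ev := by rw [pow_add, pow_one]
  have e₃ : qv ^ (d - 1) = qv ^ d / qv := by rw [pow_sub₀ _ hq hd, pow_one, div_eq_mul_inv]
  have e₄ : qv ^ (d + 2) = qv * qv * qv ^ d := by ring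
  have e₅ : qv ^ (3 * (d : ℤ) * k + 1) = qv * ((qv ^ d) ^ k) ^ 3 := by
    rw [← pow_mul, ← pow_mul, ← pow_succ', ← zpow_natCast]
    congr 1
    push_cast
    ring
  have e₆ : qv ^ 2 * qv ^ d / (qv * ev) = qv * qv ^ d / ev := by field_simp
  have e₇ : qv * (qv ^ d) ^ 2 / qv = (qv ^ d) ^ 2 := by field_simp
  have e₈ : qv * qv ^ d / qv = qv ^ d := by field_simp
  have e₉ : qv * ev / qv = ev := by field_simp
  rw [quadTerm, qInt, e₁, e₂, e₃, e₄, e₅, e₆, e₇, e₈, e₉, pow_mul]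
  ring

/-- Theorem 1.1: for even `d ≥ 2` and `n ≡ d+1 (mod 2d)`,
`Σ_{k=0}^{(dn+n-1)/(2d)} [3dk+1] (q,e,q^{1+d}/e;q^{2d})_k (q,q,q^{d-1};q^d)_k /
((q^d,e,q^{1+d}/e;q^d)_k (q^{2d},q^{2d},q^{d+2};q^{2d})_k) · q^{dk} ≡ 0 (mod Φ_n(q)^3)`. -/
theorem stmt0 (d : ℕ) (hd2 : 2 ≤ d) (hdeven : Even d) (n : ℕ) (hn : 0 < n)
    (hmod : n % (2 * d) = (d + 1) % (2 * d)) :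
    CongrMod2
      (∑ k ∈ Finset.range ((d * n + n - 1) / (2 * d) + 1),
        qInt qv (3 * (d : ℤ) * k + 1) *
          (qPoch qv (qv ^ (2 * d)) k * qPoch ev (qv ^ (2 * d)) k *
            qPoch (qv ^ (1 + d) / ev) (qv ^ (2 * d)) k) *
          (qPoch qv (qv ^ d) k * qPoch qv (qv ^ d) k * qPoch (qv ^ (d - 1)) (qv ^ d) k) /
          (qPoch (qv ^ d) (qv ^ d) k * qPoch ev (qv ^ d) k *
            qPoch (qv ^ (1 + d) / ev) (qv ^ d) k *
            (qPoch (qv ^ (2 * d)) (qv ^ (2 * d)) k * qPoch (qv ^ (2 * d)) (qv ^ (2 * d)) k *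
              qPoch (qv ^ (d + 2)) (qv ^ (2 * d)) k)) *
          qv ^ (d * k))
      0 (Phi2 n ^ 3) := by
  obtain ⟨t, rfl⟩ := hdeven.exists_two_nsmul
  rw [smul_eq_mul] at hd2 hmod ⊢
  have ht : 0 < t := by omega
  obtain ⟨m, hm⟩ : ∃ m, n = 2 * t * (2 * m + 1) + 1 := by
    refine ⟨n / (2 * (2 * t)), ?_⟩
    have h := Nat.div_add_mod n (2 * (2 * t))
    rw [hmod, Nat.mod_eq_of_lt (by omega)] at h
    linarith
  obtain ⟨M, hM⟩ : ∃ M, M = 2 * t * m + t + m + 1 := ⟨_, rfl⟩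
  have hdiv : (2 * t * n + n - 1) / (2 * (2 * t)) = M := by
    refine Nat.div_eq_of_eq_mul_right (by omega) ?_
    have : 2 * t * n + n = 2 * (2 * t) * M + 1 := by
      rw [hm, hM]
      ring
    omega
  simp only [hdiv, summand_eq_quadTerm (show 0 < 2 * t by omega)]
  rw [← Finset.sum_div]
  obtain ⟨ζ, hζ⟩ : ∃ ζ : ℂ, IsPrimitiveRoot ζ n :=
    ⟨_, Complex.isPrimitiveRoot_exp n (by omega)⟩
  let den (j : ℕ) : R2 := quadDen (MvPolynomial.X 0 ^ (2 * t)) (MvPolynomial.X 1)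
    (MvPolynomial.X 0) (MvPolynomial.X 0) (MvPolynomial.X 0) j
  have hmap (j : ℕ) : algebraMap R2 K2 (den j) = quadDen (qv ^ (2 * t)) ev qv qv qv j := by
    rw [map_quadDen, map_pow]
    rfl
  have hden (j : ℕ) (hj : j < M) : MvPolynomial.aeval ![ζ, 0] (den j) ≠ 0 := by
    have h := map_quadDen (MvPolynomial.aeval (R := ℚ) ![ζ, 0]).toRingHom
      (MvPolynomial.X 0 ^ (2 * t)) (MvPolynomial.X 1) (MvPolynomial.X 0) (MvPolynomial.X 0)
      (MvPolynomial.X 0) j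
    simp only [AlgHom.toRingHom_eq_coe, RingHom.coe_coe, map_pow, MvPolynomial.aeval_X,
      Matrix.cons_val_zero, Matrix.cons_val_one] at h
    rw [h]
    exact quadDen_primitiveRoot_ne_zero ht hM hj hm hζ
  have hden' (j : ℕ) (hj : j < M) : quadDen (qv ^ (2 * t)) ev qv qv qv j ≠ 0 := by
    rw [← hmap]
    intro h
    rw [map_eq_zero_iff _ algebraMap_R2_injective] at h
    exact hden j hj (by rw [h, map_zero])
  obtain ⟨f, k, hf⟩ := quadSum_congruence ht hM hm
  rw [quadSum_eq ev_ne_zero qv_ne_zero qv_ne_zero qv_ne_zero M hden'] at hf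
  refine congrMod2_zero_of_mul_eq (f := f) hn hζ (g := (1 - MvPolynomial.X 0) *
    (∏ j ∈ range M, den j) * MvPolynomial.X 0 ^ k) ?_ ?_
  · have hζ1 : ζ ≠ 1 := hζ.ne_one (by nlinarith)
    simp only [map_mul, map_sub, map_one, map_prod, map_pow, MvPolynomial.aeval_X,
      Matrix.cons_val_zero]
    refine mul_ne_zero (mul_ne_zero (sub_ne_zero.2 hζ1.symm) ?_)
      (pow_ne_zero _ (hζ.ne_zero hn.ne'))
    exact Finset.prod_ne_zero_iff.2 fun j hj => hden j (Finset.mem_range.1 hj)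
  · have hq1 : 1 - qv ≠ 0 := sub_ne_zero.2 fun h => qv_pow_succ_ne_one 0 (by simp [← h])
    rw [← hf]
    simp only [map_mul, map_sub, map_one, map_prod, map_pow, hmap,
      show algebraMap R2 K2 (MvPolynomial.X 0) = qv from rfl]
    field_simp

end
end

section
/- Let d ≥ 2 be an even integer and let p be a prime with p ≡ d+1 (mod 2d). Then the rational number Σ_{k=0}^{(dp+p−1)/(2d)} (3dk+1) · (1/d)_k² ((d−1)/d)_k (1/(2d))_k / (k!³ · 4^k · ((d+2)/(2d))_k) is congruent to 0 modulo p³, i.e., its p-adic valuation is at least 3. -/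
open Finset

noncomputable section

/-- The Pochhammer symbol `(a)_k = a(a+1)⋯(a+k-1)` for a rational number `a`. -/
def poch (a : ℚ) (k : ℕ) : ℚ := ∏ j ∈ Finset.range k, (a + j)

theorem poch_zero (a : ℚ) : poch a 0 = 1 := by simp [poch]

theorem poch_succ (a : ℚ) (k : ℕ) : poch a (k + 1) = poch a k * (a + k) := by
  simp [poch, prod_range_succ]

theorem poch_add_one_mul (a : ℚ) (k : ℕ) : poch (a + 1) k * a = poch a k * (a + k) := by
  induction k with
  | zero => simp [poch_zero]
  | succ k ih =>
    rw [poch_succ, poch_succ]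
    push_cast
    linear_combination (a + 1 + k) * ih

theorem poch_add_two_mul (a : ℚ) (k : ℕ) :
    poch (a + 2) k * (a * (a + 1)) = poch a k * ((a + k) * (a + k + 1)) := by
  have h₁ := poch_add_one_mul a k
  have h₂ := poch_add_one_mul (a + 1) k
  rw [add_assoc, one_add_one_eq_two] at h₂
  linear_combination a * h₂ + (a + 1 + k) * h₁

theorem poch_ne_zero {a : ℚ} (h : ∀ j : ℕ, a + j ≠ 0) (k : ℕ) : poch a k ≠ 0 :=
  prod_ne_zero_iff.mpr fun j _ => h j

theorem poch_neg_natCast_eq_zero {n k : ℕ} (h : n < k) : poch (-(n : ℚ)) k = 0 :=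
  prod_eq_zero (mem_range.mpr h) (by simp)

theorem poch_one (k : ℕ) : poch 1 k = k.factorial := by
  induction k with
  | zero => simp [poch_zero]
  | succ k ih => rw [poch_succ, ih, Nat.factorial_succ]; push_cast; ring

/-- The hypergeometric summand, without its linear factor `a + 3k`. -/
def hyperTerm (a b : ℚ) (k : ℕ) : ℚ :=
  poch a k * poch b k * poch (1 - b) k * poch (a / 2) k /
    ((k.factorial : ℚ) ^ 2 * 4 ^ k * (poch (1 + (a - b) / 2) k * poch ((a + b + 1) / 2) k))

/-- The partial sum of the hypergeometric series. -/
def hyperSum (a b : ℚ) (K : ℕ) : ℚ := ∑ k ∈ range K, (a + 3 * k) * hyperTerm a b k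

theorem hyperTerm_succ (a b : ℚ) (k : ℕ) :
    hyperTerm a b (k + 1) = hyperTerm a b k *
      (((a + k) * (b + k) * (1 - b + k) * (a / 2 + k)) /
        ((k + 1) ^ 2 * 4 * ((1 + (a - b) / 2 + k) * ((a + b + 1) / 2 + k)))) := by
  simp only [hyperTerm, poch_succ, Nat.factorial_succ, pow_succ, div_mul_div_comm]
  push_cast
  congr 1 <;> ring

/-- The denominators of `hyperTerm a b` do not vanish. -/
def Regular (a b : ℚ) : Prop :=
  (∀ j : ℕ, 1 + (a - b) / 2 + j ≠ 0) ∧ ∀ j : ℕ, (a + b + 1) / 2 + j ≠ 0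

theorem hyperTerm_add_two_left {a b : ℚ} (ha : a ≠ 0) (ha' : a + 1 ≠ 0) (h : Regular a b) (k : ℕ) :
    hyperTerm (a + 2) b k = hyperTerm a b k *
      (((a + k) * (a + k + 1) * (a / 2 + k) * ((1 + (a - b) / 2) * ((a + b + 1) / 2))) /
        (a * (a + 1) * (a / 2) * ((1 + (a - b) / 2 + k) * ((a + b + 1) / 2 + k)))) := by
  have e₁ := poch_add_two_mul a k
  have e₂ := poch_add_one_mul (a / 2) k
  have e₃ := poch_add_one_mul (1 + (a - b) / 2) k
  have e₄ := poch_add_one_mul ((a + b + 1) / 2) k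
  have n₁ := h.1 0
  have n₂ := h.2 0
  have n₃ := h.1 k
  have n₄ := h.2 k
  have p₁ := poch_ne_zero h.1 k
  have p₂ := poch_ne_zero h.2 k
  simp only [Nat.cast_zero, add_zero] at n₁ n₂
  have ha2 : a / 2 ≠ 0 := by simpa using ha
  simp only [hyperTerm]
  rw [show (a + 2) / 2 = a / 2 + 1 by ring, show 1 + (a + 2 - b) / 2 = 1 + (a - b) / 2 + 1 by ring,
    show (a + 2 + b + 1) / 2 = (a + b + 1) / 2 + 1 by ring,
    eq_div_of_mul_eq (mul_ne_zero ha ha') e₁, eq_div_of_mul_eq ha2 e₂, eq_div_of_mul_eq n₁ e₃,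
    eq_div_of_mul_eq n₂ e₄]
  generalize 1 + (a - b) / 2 = u at *
  generalize (a + b + 1) / 2 = v at *
  generalize a / 2 = w at *
  field_simp

theorem hyperTerm_add_two_right {a b : ℚ} (hb : b ≠ 0) (hb' : b + 1 ≠ 0)
    (hbk : ∀ j : ℕ, (j : ℚ) - b ≠ 0) (hbk' : ∀ j : ℕ, (j : ℚ) - b - 1 ≠ 0) (hab : a - b ≠ 0)
    (h : Regular a b) (k : ℕ) :
    hyperTerm a (b + 2) k = hyperTerm a b k *
      (((b + k) * (b + k + 1) * (((a - b) / 2 + k) * ((a + b + 1) / 2))) /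
        ((k - b) * (k - b - 1) * ((a - b) / 2 * ((a + b + 1) / 2 + k)))) := by
  have e₁ := poch_add_two_mul b k
  have e₂ := poch_add_two_mul (-1 - b) k
  have e₃ := poch_add_one_mul ((a - b) / 2) k
  have e₄ := poch_add_one_mul ((a + b + 1) / 2) k
  have n₂ := h.2 0
  have n₃ := h.1 k
  have n₄ := h.2 k
  have p₁ := poch_ne_zero h.1 k
  have p₂ := poch_ne_zero h.2 k
  have q₁ := hbk k
  have q₂ := hbk' k
  simp only [Nat.cast_zero, add_zero] at n₂
  have hab2 : (a - b) / 2 ≠ 0 := by simpa using hab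
  have r : (a - b) / 2 + k ≠ 0 := by
    cases k with
    | zero => simpa using hab2
    | succ k =>
      have := h.1 k
      push_cast
      intro h'
      exact this (by linarith)
  have e₅ : poch ((a - b) / 2) k = poch (1 + (a - b) / 2) k * ((a - b) / 2) / ((a - b) / 2 + k) :=
    eq_div_of_mul_eq r (by rw [add_comm 1]; linear_combination -e₃)
  have e₆ : poch (-1 - b) k = poch (1 - b) k * (b * (b + 1)) / ((k - b) * (k - b - 1)) := by
    refine eq_div_of_mul_eq (mul_ne_zero q₁ q₂) ?_
    rw [show -1 - b + 2 = 1 - b by ring] at e₂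
    linear_combination -e₂
  simp only [hyperTerm]
  rw [show 1 - (b + 2) = -1 - b by ring, show 1 + (a - (b + 2)) / 2 = (a - b) / 2 by ring,
    show (a + (b + 2) + 1) / 2 = (a + b + 1) / 2 + 1 by ring,
    eq_div_of_mul_eq (mul_ne_zero hb hb') e₁, e₆, e₅, eq_div_of_mul_eq n₂ e₄]
  generalize 1 + (a - b) / 2 = u at *
  generalize (a + b + 1) / 2 = v at *
  generalize (a - b) / 2 = w at *
  field_simp

theorem hyperSum_add_two_left {a b : ℚ} (ha : a ≠ 0) (ha' : a + 1 ≠ 0) (h : Regular a b) (K : ℕ) :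
    a * (a + 1) * hyperSum (a + 2) b K - (a - b + 2) * (a + b + 1) * hyperSum a b K =
      -2 * ((a - b + 2) * (a + b + 1) / a) * K ^ 2 * hyperTerm a b K := by
  induction K with
  | zero => simp [hyperSum]
  | succ k ih =>
    simp only [hyperSum, sum_range_succ] at ih ⊢
    rw [mul_add (a * (a + 1)), mul_add ((a - b + 2) * (a + b + 1)), add_sub_add_comm, ih,
      hyperTerm_add_two_left ha ha' h, hyperTerm_succ]
    have n₃ : a - b + 2 + 2 * k ≠ 0 := fun h' => h.1 k (by linarith)
    have n₄ : a + b + 1 + 2 * k ≠ 0 := fun h' => h.2 k (by linarith)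
    rw [show 1 + (a - b) / 2 + k = (a - b + 2 + 2 * k) / 2 by ring,
      show (a + b + 1) / 2 + k = (a + b + 1 + 2 * k) / 2 by ring]
    have : (k : ℚ) + 1 ≠ 0 := by positivity
    push_cast
    field_simp
    ring

theorem hyperSum_add_two_right {a b : ℚ} (hb : b ≠ 0) (hb' : b + 1 ≠ 0)
    (hbk : ∀ j : ℕ, (j : ℚ) - b ≠ 0) (hbk' : ∀ j : ℕ, (j : ℚ) - b - 1 ≠ 0) (hab : a - b ≠ 0)
    (h : Regular a b) (K : ℕ) :
    (a - b) * (1 + b) * hyperSum a (b + 2) K + (a + b + 1) * b * hyperSum a b K =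
      -2 * ((a + b + 1) * (2 * b + 1)) * K ^ 2 * (a - b + 2 * K) / ((K - b) * (K - b - 1)) *
        hyperTerm a b K := by
  induction K with
  | zero => simp [hyperSum]
  | succ k ih =>
    simp only [hyperSum, sum_range_succ] at ih ⊢
    rw [mul_add ((a - b) * (1 + b)), mul_add ((a + b + 1) * b), add_add_add_comm, ih,
      hyperTerm_add_two_right hb hb' hbk hbk' hab h, hyperTerm_succ]
    have n₃ : a - b + 2 + 2 * k ≠ 0 := fun h' => h.1 k (by linarith)
    have n₄ : a + b + 1 + 2 * k ≠ 0 := fun h' => h.2 k (by linarith)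
    have q₁ := hbk k
    have q₂ := hbk' k
    have q₃ := hbk (k + 1)
    rw [show 1 + (a - b) / 2 + k = (a - b + 2 + 2 * k) / 2 by ring,
      show (a + b + 1) / 2 + k = (a + b + 1 + 2 * k) / 2 by ring]
    have : (k : ℚ) + 1 ≠ 0 := by positivity
    push_cast at q₃ ⊢
    rw [show (k : ℚ) + 1 - b - 1 = k - b by ring]
    field_simp
    ring

theorem hyperSum_zero_left (b : ℚ) (K : ℕ) : hyperSum 0 b K = 0 := by
  refine sum_eq_zero fun k _ => ?_
  cases k with
  | zero => simp
  | succ k =>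
    have := poch_neg_natCast_eq_zero (n := 0) (Nat.succ_pos k)
    simp only [Nat.cast_zero, neg_zero] at this
    simp [hyperTerm, this]

theorem hyperSum_neg_one_left {b : ℚ} (hb : b ≠ 0) (hb' : b ≠ 1) (K : ℕ) :
    hyperSum (-1) b (K + 2) = 0 := by
  induction K with
  | zero =>
    have h₁ : 1 - b ≠ 0 := sub_ne_zero.mpr hb'.symm
    have h₂ : 1 + (-1 - b) / 2 = (1 - b) / 2 := by ring
    simp only [hyperSum, zero_add, sum_range_succ, sum_range_zero, hyperTerm, poch_succ, poch_zero,
      Nat.factorial, h₂]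
    norm_num
    field_simp
    ring
  | succ K ih =>
    have := poch_neg_natCast_eq_zero (n := 1) (k := K + 2) (by lia)
    simp only [Nat.cast_one] at this
    rw [hyperSum, show K + 1 + 2 = K + 2 + 1 by ring, sum_range_succ, ← hyperSum, ih, hyperTerm,
      this]
    simp

/-- The series terminates and sums to zero when `a` is a nonpositive integer. -/
theorem hyperSum_neg_natCast_left {b : ℚ} (M K : ℕ) (hb : (M : ℚ) < b + 1)
    (hb' : ∀ i : ℤ, b + M ≠ 2 * i) (hK : M < K ∨ Even M ∧ M < 2 * K) :
    hyperSum (-(M : ℚ)) b K = 0 := by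
  induction M using Nat.twoStepInduction with
  | zero => simpa using hyperSum_zero_left b K
  | one =>
    obtain ⟨K, rfl⟩ : ∃ L, K = L + 2 := ⟨K - 2, by
      have := Nat.not_even_one
      lia⟩
    refine hyperSum_neg_one_left (fun h => ?_) (fun h => ?_) K
    · rw [h] at hb; norm_num at hb
    · exact hb' 1 (by rw [h]; norm_num)
  | more M ih _ =>
    have ih' : hyperSum (-((M + 2 : ℕ) : ℚ) + 2) b K = 0 := by
      rw [show -((M + 2 : ℕ) : ℚ) + 2 = -(M : ℚ) by push_cast; ring]
      refine ih ?_ (fun i h => hb' (i + 1) ?_) ?_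
      · push_cast at hb; linarith
      · push_cast; linarith
      · simp only [Nat.even_add, even_two, iff_true] at hK
        lia
    have hreg : Regular (-((M + 2 : ℕ) : ℚ)) b := by
      refine ⟨fun j h => hb' (j + 1) ?_, fun j => ?_⟩
      · push_cast at h ⊢; linarith
      · have : (0 : ℚ) ≤ j := j.cast_nonneg
        intro h; linarith
    have hM : (0 : ℚ) ≤ M := M.cast_nonneg
    have key := hyperSum_add_two_left (by push_cast; linarith) (by push_cast; linarith) hreg K
    have hz : hyperTerm (-((M + 2 : ℕ) : ℚ)) b K = 0 := by
      rw [hyperTerm]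
      rcases hK with h | ⟨⟨c, hc⟩, h⟩
      · rw [poch_neg_natCast_eq_zero h]; simp
      · rw [hc, show -((c + c : ℕ) : ℚ) / 2 = -(c : ℚ) by push_cast; ring,
          poch_neg_natCast_eq_zero (n := c) (by lia)]
        simp
    have n₁ := hreg.1 0
    have n₂ := hreg.2 0
    rw [ih', hz, mul_zero, mul_zero, zero_sub, neg_eq_zero] at key
    refine (mul_eq_zero.mp key).resolve_left (mul_ne_zero (fun h => n₁ ?_) (fun h => n₂ ?_)) <;>
    · push_cast at h ⊢; linarith

theorem regular_neg_natCast_right {a : ℚ} {n : ℕ} (ha : (n : ℚ) < a + 1) :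
    Regular a (-(n : ℚ)) := by
  refine ⟨fun j h => ?_, fun j h => ?_⟩ <;>
  · have h₁ : (0 : ℚ) ≤ j := j.cast_nonneg
    have h₂ : (0 : ℚ) ≤ n := n.cast_nonneg
    linarith

theorem hyperSum_neg_one_right {a : ℚ} (ha : 0 < a) (K : ℕ) : hyperSum a (-1) (K + 2) = 0 := by
  induction K with
  | zero =>
    have h₁ : a + 3 ≠ 0 := by positivity
    have h₂ : 1 + (a - -1) / 2 = (a + 3) / 2 := by ring
    simp only [hyperSum, zero_add, sum_range_succ, sum_range_zero, hyperTerm, poch_succ, poch_zero,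
      Nat.factorial, h₂]
    norm_num
    field_simp
    ring
  | succ K ih =>
    have := poch_neg_natCast_eq_zero (n := 1) (k := K + 2) (by lia)
    simp only [Nat.cast_one] at this
    rw [hyperSum, show K + 1 + 2 = K + 2 + 1 by ring, sum_range_succ, ← hyperSum, ih, hyperTerm,
      this]
    simp

/-- The series terminates and sums to zero when `b` is a negative odd integer. -/
theorem hyperSum_neg_odd_right {a : ℚ} (i K : ℕ) (ha : ((2 * i + 1 : ℕ) : ℚ) < a + 1)
    (hK : 2 * i + 1 < K) : hyperSum a (-((2 * i + 1 : ℕ) : ℚ)) K = 0 := by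
  induction i with
  | zero =>
    obtain ⟨K, rfl⟩ : ∃ L, K = L + 2 := ⟨K - 2, by lia⟩
    simp only [mul_zero, zero_add, Nat.cast_one] at ha ⊢
    exact hyperSum_neg_one_right (by linarith) K
  | succ i ih =>
    have ih' : hyperSum a (-((2 * (i + 1) + 1 : ℕ) : ℚ) + 2) K = 0 := by
      rw [show -((2 * (i + 1) + 1 : ℕ) : ℚ) + 2 = -((2 * i + 1 : ℕ) : ℚ) by push_cast; ring]
      refine ih ?_ (by lia)
      push_cast at ha ⊢; linarith
    have hreg := regular_neg_natCast_right ha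
    have hi : (0 : ℚ) ≤ i := i.cast_nonneg
    have hz : hyperTerm a (-((2 * (i + 1) + 1 : ℕ) : ℚ)) K = 0 := by
      rw [hyperTerm, poch_neg_natCast_eq_zero hK]; simp
    have key := hyperSum_add_two_right (a := a) (b := -((2 * (i + 1) + 1 : ℕ) : ℚ))
      (by push_cast; intro h; linarith) (by push_cast; intro h; linarith)
      (fun j h => by
        have : (0 : ℚ) ≤ j := j.cast_nonneg
        push_cast at h; linarith)
      (fun j h => by
        have : (0 : ℚ) ≤ j := j.cast_nonneg
        push_cast at h; linarith)
      (by push_cast at ha ⊢; intro h; linarith) hreg K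
    rw [ih', hz, mul_zero, mul_zero, zero_add] at key
    refine (mul_eq_zero.mp key).resolve_left (mul_ne_zero (fun h => ?_) ?_)
    · linarith
    · push_cast; intro h; linarith

/-- The subring of rationals whose denominator is not divisible by the prime `p`. -/
def integralAt (p : ℕ) (hp : p.Prime) : Subring ℚ where
  carrier := {q | ¬ p ∣ q.den}
  mul_mem' {x y} hx hy h :=
    ((hp.dvd_mul).mp (h.trans (Rat.mul_den_dvd x y))).elim hx hy
  one_mem' h := hp.one_lt.ne' (Nat.dvd_one.mp h)
  add_mem' {x y} hx hy h :=
    ((hp.dvd_mul).mp (h.trans (Rat.add_den_dvd x y))).elim hx hy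
  zero_mem' h := hp.one_lt.ne' (Nat.dvd_one.mp h)
  neg_mem' {x} hx := by simpa using hx

theorem inv_natCast_mem_integralAt {p : ℕ} (hp : p.Prime) {n : ℕ} (h : ¬ p ∣ n) :
    (n : ℚ)⁻¹ ∈ integralAt p hp := by
  change ¬ p ∣ ((n : ℚ)⁻¹).den
  rw [Rat.inv_natCast_den]
  split_ifs with h0
  · exact hp.one_lt.ne' ∘ Nat.dvd_one.mp
  · exact h

open Polynomial in
/-- A polynomial over a subring with three distinct roots there is divisible by the three
corresponding linear factors. -/
theorem eval_eq_mul_of_roots {R : Subring ℚ} {P : ℚ[X]} (hP : P ∈ lifts R.subtype)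
    {r₁ r₂ r₃ x : ℚ} (h₁ : r₁ ∈ R) (h₂ : r₂ ∈ R) (h₃ : r₃ ∈ R) (hx : x ∈ R)
    (h₁₂ : r₁ ≠ r₂) (h₁₃ : r₁ ≠ r₃) (h₂₃ : r₂ ≠ r₃)
    (e₁ : P.eval r₁ = 0) (e₂ : P.eval r₂ = 0) (e₃ : P.eval r₃ = 0) :
    ∃ s ∈ R, P.eval x = (x - r₁) * (x - r₂) * (x - r₃) * s := by
  obtain ⟨Q, rfl⟩ := hP
  have hev : ∀ (S : R[X]) (y : R), (S.map R.subtype).eval (y : ℚ) = (S.eval y : R) :=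
    fun S y => eval_map_apply (f := R.subtype) ..
  lift r₁ to R using h₁
  lift r₂ to R using h₂
  lift r₃ to R using h₃
  lift x to R using hx
  simp only [coe_mapRingHom, hev, ZeroMemClass.coe_eq_zero, ne_eq, SetLike.coe_eq_coe] at *
  obtain ⟨Q₁, rfl⟩ := dvd_iff_isRoot.mpr e₁
  have e₂' : Q₁.eval r₂ = 0 := by
    simpa [sub_ne_zero.mpr (Ne.symm h₁₂)] using e₂
  obtain ⟨Q₂, rfl⟩ := dvd_iff_isRoot.mpr e₂'
  have e₃' : Q₂.eval r₃ = 0 := by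
    simpa [sub_ne_zero.mpr (Ne.symm h₁₃), sub_ne_zero.mpr (Ne.symm h₂₃)] using e₃
  obtain ⟨Q₃, rfl⟩ := dvd_iff_isRoot.mpr e₃'
  refine ⟨_, (Q₃.eval x).2, ?_⟩
  simp [mul_assoc]

open Polynomial in
/-- The partial sum `hyperSum x (2c - x) (N + 1)` as a polynomial in `x`, after multiplication by
its common denominator `poch (1 + x - c) N`. -/
def hyperPoly (c : ℚ) (N : ℕ) : ℚ[X] :=
  ∑ k ∈ range (N + 1), C ((k.factorial : ℚ) ^ 2 * 4 ^ k * poch (c + 1 / 2) k)⁻¹ *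
    ((X + C (3 * k : ℚ)) * (∏ j ∈ range k, (X + C (j : ℚ))) *
      (∏ j ∈ range k, (C (-1) * X + C (2 * c + j))) * (∏ j ∈ range k, (X + C (1 - 2 * c + j))) *
      (∏ j ∈ range k, (C (1 / 2) * X + C (j : ℚ))) * ∏ j ∈ Ico k N, (X + C (1 - c + j)))

theorem eval_hyperPoly {c x : ℚ} (N : ℕ) (h : ∀ j : ℕ, 1 + x - c + j ≠ 0) :
    (hyperPoly c N).eval x = hyperSum x (2 * c - x) (N + 1) * poch (1 + x - c) N := by
  simp only [hyperPoly, hyperSum, sum_mul, Polynomial.eval_finsetSum]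
  refine sum_congr rfl fun k hk => ?_
  have hkN : k ≤ N := Nat.lt_succ_iff.mp (mem_range.mp hk)
  have hsplit : poch (1 + x - c) N = poch (1 + x - c) k * ∏ j ∈ Ico k N, (x + (1 - c + j)) := by
    simp only [poch]
    rw [← prod_range_mul_prod_Ico _ hkN]
    congr 1
    exact prod_congr rfl fun j _ => by ring
  have e₁ : ∏ j ∈ range k, (-1 * x + (2 * c + j)) = poch (2 * c - x) k :=
    prod_congr rfl fun j _ => by ring
  have e₂ : ∏ j ∈ range k, (x + (1 - 2 * c + j)) = poch (1 - (2 * c - x)) k :=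
    prod_congr rfl fun j _ => by ring
  have e₃ : ∏ j ∈ range k, (1 / 2 * x + (j : ℚ)) = poch (x / 2) k :=
    prod_congr rfl fun j _ => by ring
  have e₄ : ∏ j ∈ range k, (x + (j : ℚ)) = poch x k := rfl
  have hne := poch_ne_zero h k
  rw [hsplit, hyperTerm, show 1 + (x - (2 * c - x)) / 2 = 1 + x - c by ring,
    show (x + (2 * c - x) + 1) / 2 = c + 1 / 2 by ring]
  simp only [Polynomial.eval_mul, Polynomial.eval_add, Polynomial.eval_C, Polynomial.eval_X,
    Polynomial.eval_prod, e₁, e₂, e₃, e₄]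
  generalize poch (c + 1 / 2) k = w
  generalize poch (1 + x - c) k = u at hne ⊢
  field_simp

open Polynomial in
theorem hyperPoly_mem_lifts {R : Subring ℚ} {c : ℚ} {N : ℕ} (hc : c ∈ R) (h2 : (1 / 2 : ℚ) ∈ R)
    (hcoeff : ∀ k ≤ N, ((k.factorial : ℚ) ^ 2 * 4 ^ k * poch (c + 1 / 2) k)⁻¹ ∈ R) :
    hyperPoly c N ∈ lifts R.subtype := by
  have hC : ∀ q ∈ R, C q ∈ lifts R.subtype := fun q hq => C_mem_lifts R.subtype ⟨q, hq⟩
  have hX : X ∈ lifts R.subtype := X_mem_lifts _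
  have hnat : ∀ n : ℕ, (n : ℚ) ∈ R := natCast_mem R
  have h2c : 2 * c ∈ R := mul_mem (hnat 2) hc
  refine sum_mem fun k hk => mul_mem (hC _ (hcoeff k (Nat.lt_succ_iff.mp (mem_range.mp hk)))) ?_
  refine mul_mem (mul_mem (mul_mem (mul_mem (mul_mem ?_ ?_) ?_) ?_) ?_) ?_
  · exact add_mem hX (hC _ (mul_mem (hnat 3) (hnat k)))
  · exact prod_mem fun j _ => add_mem hX (hC _ (hnat j))
  · exact prod_mem fun j _ => add_mem (mul_mem (hC _ (neg_mem (one_mem R))) hX)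
      (hC _ (add_mem h2c (hnat j)))
  · exact prod_mem fun j _ => add_mem hX (hC _ (add_mem (sub_mem (one_mem R) h2c) (hnat j)))
  · exact prod_mem fun j _ => add_mem (mul_mem (hC _ h2) hX) (hC _ (hnat j))
  · exact prod_mem fun j _ => add_mem hX (hC _ (add_mem (sub_mem (one_mem R) hc) (hnat j)))

/-- The prime `p = 1 + 2e(2i + 1)` does not divide the numerators of `poch ((e + 1) / (2e)) k`
in the range of summation. -/
theorem not_dvd_numerator {e i p j N : ℕ} (he : 1 ≤ e) (hp : p = 1 + 2 * e * (2 * i + 1))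
    (hN : 2 * N = p + (2 * i + 1)) (hj : j < N) : ¬ p ∣ e + 1 + 2 * e * j := by
  rintro ⟨t, ht⟩
  have hmod : (e + 1) % (2 * e) = t % (2 * e) := by
    have h₁ : (e + 1 + 2 * e * j) % (2 * e) = (e + 1) % (2 * e) := Nat.add_mul_mod_self_left ..
    have h₂ : p * t = t + 2 * e * ((2 * i + 1) * t) := by rw [hp]; ring
    rw [← h₁, ht, h₂, Nat.add_mul_mod_self_left]
  have ht' : e + 1 ≤ t := by
    have htpos : 0 < t := Nat.pos_of_ne_zero fun h => by rw [h] at ht; lia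
    rcases he.eq_or_lt with rfl | he'
    · lia
    · rw [Nat.mod_eq_of_lt (by lia : e + 1 < 2 * e)] at hmod
      exact hmod ▸ Nat.mod_le t (2 * e)
  have h₁ : p * (e + 1) ≤ e + 1 + 2 * e * j := ht ▸ Nat.mul_le_mul_left p ht'
  have h₂ : 2 * e * (j + 1) ≤ 2 * e * N := Nat.mul_le_mul_left _ hj
  have h₃ : 2 * e * N = e * (2 * N) := by ring
  rw [h₃, hN] at h₂
  nlinarith

/-- For even `d ≥ 2` and a prime `p ≡ d+1 (mod 2d)`,
`Σ_{k=0}^{(dp+p-1)/(2d)} (3dk+1) (1/d)_k² ((d-1)/d)_k (1/(2d))_k / (k!³ 4^k ((d+2)/(2d))_k)`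
is `p³` times a rational number whose denominator is not divisible by `p`. -/
theorem stmt3 (d : ℕ) (hd2 : 2 ≤ d) (hdeven : Even d) (p : ℕ) (hp : p.Prime)
    (hmod : p % (2 * d) = (d + 1) % (2 * d)) :
    ∃ s : ℚ,
      (∑ k ∈ Finset.range ((d * p + p - 1) / (2 * d) + 1),
        (3 * (d : ℚ) * k + 1) *
          (poch (1 / d) k ^ 2 * poch (((d : ℚ) - 1) / d) k * poch (1 / (2 * d)) k) /
          ((k.factorial : ℚ) ^ 3 * 4 ^ k * poch (((d : ℚ) + 2) / (2 * d)) k))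
        = (p : ℚ) ^ 3 * s ∧ ¬ (p ∣ s.den) := by
  obtain ⟨e, he⟩ := hdeven
  obtain ⟨i, hi⟩ : ∃ i, p = 1 + d * (2 * i + 1) := by
    refine ⟨p / (2 * d), ?_⟩
    rw [Nat.mod_eq_of_lt (by lia : d + 1 < 2 * d)] at hmod
    have := Nat.div_add_mod p (2 * d)
    rw [hmod] at this
    linarith
  obtain ⟨N, hN⟩ : ∃ N, 2 * N = p + (2 * i + 1) :=
    ⟨e * (2 * i + 1) + i + 1, by rw [hi, he]; ring⟩
  have hlast : (d * p + p - 1) / (2 * d) = N := by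
    refine Nat.div_eq_of_eq_mul_right (by lia) ?_
    have : 2 * d * N = d * p + d * (2 * i + 1) := by rw [← mul_add, ← hN]; ring
    lia
  have hip : 2 * i + 1 < p := by nlinarith
  have hNp : N < p := by lia
  have hpd : ¬ p ∣ d := Nat.not_dvd_of_pos_of_lt (by lia) (by nlinarith)
  have hp2 : ¬ p ∣ 2 := Nat.not_dvd_of_pos_of_lt (by lia) (by nlinarith)
  have hd0 : (0 : ℚ) < d := by exact_mod_cast (by lia : 0 < d)
  have hpQ : (p : ℚ) = 1 + d * (2 * i + 1) := by exact_mod_cast hi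
  have hp0 : (0 : ℚ) < p := by exact_mod_cast hp.pos
  have hi0 : (0 : ℚ) ≤ i := i.cast_nonneg
  set R := integralAt p hp
  have hnat : ∀ n : ℕ, (n : ℚ) ∈ R := natCast_mem R
  set c : ℚ := (d : ℚ)⁻¹ with hcdef
  have hdc : d * c = 1 := mul_inv_cancel₀ hd0.ne'
  have hc0 : 0 < c := inv_pos.mpr hd0
  have hpc : p * c = c + (2 * i + 1) := by rw [hpQ]; linear_combination (2 * i + 1 : ℚ) * hdc
  have hcR : c ∈ R := inv_natCast_mem_integralAt hp hpd
  have h2R : (2 : ℚ)⁻¹ ∈ R := inv_natCast_mem_integralAt hp hp2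
  have hcint : ∀ n : ℤ, c ≠ n := by
    intro n hn
    have h₁ : (d : ℤ) * n = 1 := by rw [hn] at hdc; exact_mod_cast hdc
    have := Int.eq_one_or_neg_one_of_mul_eq_one h₁
    lia
  have hcoeff : ∀ k ≤ N, ((k.factorial : ℚ) ^ 2 * 4 ^ k * poch (c + 1 / 2) k)⁻¹ ∈ R := by
    intro k hk
    have hfac : (k.factorial : ℚ)⁻¹ ∈ R :=
      inv_natCast_mem_integralAt hp fun h => absurd (hp.dvd_factorial.mp h) (by lia)
    have h4 : (4 : ℚ)⁻¹ ∈ R := by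
      rw [show (4 : ℚ)⁻¹ = 2⁻¹ * 2⁻¹ by norm_num]; exact mul_mem h2R h2R
    rw [mul_inv, mul_inv, ← inv_pow, ← inv_pow, poch, ← prod_inv_distrib]
    refine mul_mem (mul_mem (pow_mem hfac 2) (pow_mem h4 k)) (prod_mem fun j hj => ?_)
    have hnd : ¬ p ∣ e + 1 + 2 * e * j :=
      not_dvd_numerator (by lia) (by rw [hi, he]; ring) hN ((mem_range.mp hj).trans_le hk)
    rw [show c + 1 / 2 + (j : ℚ) = ((e + 1 + 2 * e * j : ℕ) : ℚ) / d by
      rw [eq_div_iff hd0.ne']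
      have : (d : ℚ) = e + e := by exact_mod_cast he
      push_cast
      linear_combination hdc + (1 / 2 + j : ℚ) * this, inv_div, div_eq_mul_inv]
    exact mul_mem (hnat d) (inv_natCast_mem_integralAt hp hnd)
  have hroot₁ : (hyperPoly c N).eval (-((2 * i + 1 : ℕ) : ℚ)) = 0 := by
    rw [eval_hyperPoly N fun j h => hcint (1 - (2 * i + 1 : ℕ) + j) (by push_cast at h ⊢; linarith),
      hyperSum_neg_natCast_left _ _ (by linarith) _ (Or.inl (by lia)), zero_mul]
    intro n h
    exact hcint (n - (2 * i + 1 : ℕ)) (by push_cast at h ⊢; linarith)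
  have hroot₂ : (hyperPoly c N).eval (-((2 * N : ℕ) : ℚ)) = 0 := by
    rw [eval_hyperPoly N fun j h => hcint (1 - (2 * N : ℕ) + j) (by push_cast at h ⊢; linarith),
      hyperSum_neg_natCast_left _ _ (by linarith) _ (Or.inr ⟨even_two_mul N, by lia⟩), zero_mul]
    intro n h
    exact hcint (n - (2 * N : ℕ)) (by push_cast at h ⊢; linarith)
  have hroot₃ : (hyperPoly c N).eval (2 * c + (2 * i + 1 : ℕ)) = 0 := by
    rw [eval_hyperPoly N fun j h => by
      have : (0 : ℚ) ≤ j := j.cast_nonneg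
      push_cast at h; linarith]
    rw [show 2 * c - (2 * c + (2 * i + 1 : ℕ)) = -((2 * i + 1 : ℕ) : ℚ) by ring,
      hyperSum_neg_odd_right _ _ (by linarith) (by lia), zero_mul]
  have hNQ : 2 * (N : ℚ) = p + (2 * i + 1) := by exact_mod_cast hN
  obtain ⟨s, hs, hval⟩ := eval_eq_mul_of_roots (hyperPoly_mem_lifts hcR (by simpa using h2R) hcoeff)
    (neg_mem (hnat (2 * i + 1))) (neg_mem (hnat (2 * N)))
    (add_mem (mul_mem (hnat 2) hcR) (hnat (2 * i + 1))) hcR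
    (by push_cast; intro h; linarith) (by push_cast; intro h; linarith)
    (by push_cast; intro h; linarith) hroot₁ hroot₂ hroot₃
  rw [eval_hyperPoly N fun j => by rw [add_sub_cancel_right]; positivity, add_sub_cancel_right,
    poch_one, show 2 * c - c = c by ring] at hval
  have hfacR : (N.factorial : ℚ)⁻¹ ∈ R :=
    inv_natCast_mem_integralAt hp fun h => absurd (hp.dvd_factorial.mp h) (by lia)
  refine ⟨d * (c * (c + 1) * -c * s) * (N.factorial : ℚ)⁻¹, ?_, ?_⟩
  · rw [hlast]
    have hsum : ∑ k ∈ range (N + 1), (3 * (d : ℚ) * k + 1) *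
        (poch (1 / d) k ^ 2 * poch (((d : ℚ) - 1) / d) k * poch (1 / (2 * d)) k) /
          ((k.factorial : ℚ) ^ 3 * 4 ^ k * poch (((d : ℚ) + 2) / (2 * d)) k) =
        d * hyperSum c c (N + 1) := by
      rw [hyperSum, mul_sum]
      refine sum_congr rfl fun k _ => ?_
      rw [hyperTerm, sub_self, zero_div, add_zero, poch_one,
        show (1 : ℚ) / d = c by rw [one_div], show ((d : ℚ) - 1) / d = 1 - c by
          rw [hcdef]; field_simp,
        show (1 : ℚ) / (2 * d) = c / 2 by rw [hcdef]; field_simp,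
        show ((d : ℚ) + 2) / (2 * d) = (c + c + 1) / 2 by rw [hcdef]; field_simp; ring,
        show 3 * (d : ℚ) * k + 1 = d * (c + 3 * k) by linear_combination -hdc]
      rw [mul_div_assoc, mul_assoc]
      congr 3 <;> ring
    have hf : (N.factorial : ℚ) ≠ 0 := by positivity
    rw [hsum, eq_div_of_mul_eq hf hval]
    push_cast
    rw [show c - -(2 * i + 1 : ℚ) = p * c by rw [hpc]; ring,
      show c - -(2 * N : ℚ) = p * (c + 1) by rw [hNQ, mul_add, hpc]; ring,
      show c - (2 * c + (2 * i + 1 : ℚ)) = -(p * c) by rw [hpc]; ring]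
    ring
  · exact mul_mem (mul_mem (hnat d) (mul_mem (mul_mem (mul_mem hcR (add_mem hcR (one_mem R)))
      (neg_mem hcR)) hs)) hfacR

end
end
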